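/- Let G be a finite simple graph on [n] without isolated vertices and I(G) its edge ideal in S = k[x_1,…,x_n]. Then S/I(G)^2 is Cohen-Macaulay if and only if G is special Cohen-Macaulay and G contains no triangle (no three pairwise adjacent vertices). -/

import Mathlib

open MvPolynomial CategoryTheory CategoryTheory.Limits

noncomputable section

/-- A simplicial complex on a vertex set `V`: a collection of finite subsets of `V`
closed under taking subsets. -/
def IsSimplicialComplex {V : Type} (Δ : Set (Finset V)) : Prop :=
  ∀ F ∈ Δ, ∀ G : Finset V, G ⊆ F → G ∈ Δ

/-- The dimension of a simplicial complex: `max {|F| - 1 : F ∈ Δ}`. -/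
def complexDim {V : Type} (Δ : Set (Finset V)) : ℤ :=
  sSup ((fun F : Finset V => (F.card : ℤ) - 1) '' Δ)

/-- The star of a face: `st_Δ(F) = {H ∈ Δ : H ∪ F ∈ Δ}`. -/
def complexStar {V : Type} [DecidableEq V] (Δ : Set (Finset V)) (F : Finset V) :
    Set (Finset V) :=
  {H | H ∈ Δ ∧ H ∪ F ∈ Δ}

/-- The facets (maximal faces) of a simplicial complex. -/
def facets {V : Type} (Δ : Set (Finset V)) : Set (Finset V) :=
  {F | F ∈ Δ ∧ ∀ G ∈ Δ, F ⊆ G → F = G}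

/-- The Stanley–Reisner ideal of a simplicial complex `Δ`:
generated by the squarefree monomials `∏_{i ∈ F} x_i` with `F ∉ Δ`. -/
def srIdeal (k : Type) [Field k] {V : Type} (Δ : Set (Finset V)) :
    Ideal (MvPolynomial V k) :=
  Ideal.span {m | ∃ F : Finset V, F ∉ Δ ∧ m = ∏ i ∈ F, X i}

/-- The face prime `P_F = (x_j : j ∉ F)`. -/
def facePrime (k : Type) [Field k] {V : Type} (F : Finset V) :
    Ideal (MvPolynomial V k) :=
  Ideal.span ((X : V → MvPolynomial V k) '' {j | j ∉ F})

/-- The `m`-th symbolic power of the Stanley–Reisner ideal: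
`I_Δ^{(m)} = ⋂_{F facet of Δ} P_F^m`. -/
def symbolicPower (k : Type) [Field k] {V : Type} (Δ : Set (Finset V)) (m : ℕ) :
    Ideal (MvPolynomial V k) :=
  ⨅ F ∈ facets Δ, (facePrime k F) ^ m

/-- The homogeneous maximal ideal `m = (x_1, …, x_n)` of the polynomial ring. -/
def maxIdeal (k : Type) [Field k] (V : Type) : Ideal (MvPolynomial V k) :=
  Ideal.span (Set.range (X : V → MvPolynomial V k))

/-- The `i`-th local cohomology module `H^i_m(S/I)`. -/
def locCoh (k : Type) [Field k] (V : Type) (I : Ideal (MvPolynomial V k)) (i : ℕ) :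
    ModuleCat (MvPolynomial V k) :=
  (localCohomology (maxIdeal k V) i).obj
    (ModuleCat.of (MvPolynomial V k) (MvPolynomial V k ⧸ I))

/-- `S/I` is Cohen–Macaulay: `H^i_m(S/I) = 0` for all `i < dim S/I`. -/
def quotCM (k : Type) [Field k] (V : Type) (I : Ideal (MvPolynomial V k)) : Prop :=
  ∀ i : ℕ, (i : WithBot (WithTop ℕ)) < ringKrullDim (MvPolynomial V k ⧸ I) →
    Subsingleton (locCoh k V I i)

/-- `S/I` is generalized Cohen–Macaulay: `H^i_m(S/I)` has finite length for all
`i < dim S/I`. -/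
def quotGCM (k : Type) [Field k] (V : Type) (I : Ideal (MvPolynomial V k)) : Prop :=
  ∀ i : ℕ, (i : WithBot (WithTop ℕ)) < ringKrullDim (MvPolynomial V k ⧸ I) →
    IsFiniteLength (MvPolynomial V k) (locCoh k V I i)

/-- `S/I` is `r`-Buchsbaum: `m^r · H^i_m(S/I) = 0` for all `i < dim S/I`. -/
def quotKBuchsbaum (k : Type) [Field k] (V : Type) (I : Ideal (MvPolynomial V k))
    (r : ℕ) : Prop :=
  ∀ i : ℕ, (i : WithBot (WithTop ℕ)) < ringKrullDim (MvPolynomial V k ⧸ I) →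
    ∀ x ∈ (maxIdeal k V) ^ r, ∀ y : locCoh k V I i, x • y = 0

/-- The canonical map `Ext^i_S(S/m, S/I) → H^i_m(S/I)`, realized as the colimit
injection at the first power of `m` in the direct system defining local cohomology. -/
def canonicalExtToLocCoh (k : Type) [Field k] (V : Type) (I : Ideal (MvPolynomial V k))
    (i : ℕ) :
    ((localCohomology.diagram (localCohomology.idealPowersDiagram (maxIdeal k V)) i).obj
        (Opposite.op (Opposite.op (1 : ℕ)))).obj
      (ModuleCat.of (MvPolynomial V k) (MvPolynomial V k ⧸ I)) ⟶ locCoh k V I i :=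
  letI := localCohomology.hasColimitDiagram.{0,0}
    (localCohomology.idealPowersDiagram (maxIdeal k V)) i
  (colimit.ι (localCohomology.diagram (localCohomology.idealPowersDiagram (maxIdeal k V)) i)
    (Opposite.op (Opposite.op (1 : ℕ)))).app (ModuleCat.of (MvPolynomial V k) (MvPolynomial V k ⧸ I))

/-- `S/I` is Buchsbaum: the canonical map `Ext^i_S(S/m, S/I) → H^i_m(S/I)` is
surjective for all `i < dim S/I`. -/
def quotBuchsbaum (k : Type) [Field k] (V : Type) (I : Ideal (MvPolynomial V k)) : Prop :=
  ∀ i : ℕ, (i : WithBot (WithTop ℕ)) < ringKrullDim (MvPolynomial V k ⧸ I) →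
    Function.Surjective (canonicalExtToLocCoh k V I i)

/-- A simplicial complex is Cohen–Macaulay if its Stanley–Reisner ring is
Cohen–Macaulay over every field. -/
def complexCM {V : Type} (Δ : Set (Finset V)) : Prop :=
  ∀ (k : Type) [Field k], quotCM k V (srIdeal k Δ)

/-- A simplicial complex is Buchsbaum if its Stanley–Reisner ring is Buchsbaum over
every field. -/
def complexBuchsbaum {V : Type} (Δ : Set (Finset V)) : Prop :=
  ∀ (k : Type) [Field k], quotBuchsbaum k V (srIdeal k Δ)

/-- The independence complex of a graph: faces are the independent sets. -/
def indepComplex {V : Type} (G : SimpleGraph V) : Set (Finset V) :=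
  {F | ∀ i ∈ F, ∀ j ∈ F, ¬ G.Adj i j}

/-- The edge ideal `I(G) = (x_i x_j : ij ∈ E(G))`. -/
def edgeIdeal (k : Type) [Field k] {V : Type} (G : SimpleGraph V) :
    Ideal (MvPolynomial V k) :=
  Ideal.span {m | ∃ i j : V, G.Adj i j ∧ m = X i * X j}

/-- The independence number `α(G)`. -/
def indepNumber {V : Type} (G : SimpleGraph V) : ℕ :=
  sSup {c | ∃ F ∈ indepComplex G, F.card = c}

/-- A graph is Cohen–Macaulay if its independence complex is. -/
def graphCM {V : Type} (G : SimpleGraph V) : Prop :=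
  complexCM (indepComplex G)

/-- The vertex set of the localization `G_{pq} = G \ (N(p) ∪ N(q))` of `G` at an
edge `pq`. -/
def edgeLocSet {V : Type} (G : SimpleGraph V) (p q : V) : Set V :=
  {v | v ∉ G.neighborSet p ∪ G.neighborSet q}

/-- The localization of `G` at an edge `pq`: the induced subgraph on the vertices not
adjacent to `p` or `q` (this removes `p` and `q` as well). -/
def edgeLoc {V : Type} (G : SimpleGraph V) (p q : V) :
    SimpleGraph (edgeLocSet G p q) :=
  G.induce (edgeLocSet G p q)

/-- `G` is special Cohen–Macaulay: `G` is Cohen–Macaulay and for every edge `pq`,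
`G_{pq}` is Cohen–Macaulay with `α(G_{pq}) = α(G) - 1`. -/
def specialCM {V : Type} (G : SimpleGraph V) : Prop :=
  graphCM G ∧ ∀ p q : V, G.Adj p q →
    graphCM (edgeLoc G p q) ∧ indepNumber (edgeLoc G p q) + 1 = indepNumber G

/-- The vertex set of `G_i = G \ ({i} ∪ N(i))`. -/
def vertexLocSet {V : Type} (G : SimpleGraph V) (i : V) : Set V :=
  {v | v ≠ i ∧ v ∉ G.neighborSet i}

/-- `G_i = G \ ({i} ∪ N(i))`: the induced subgraph obtained by deleting `i` and all
its neighbors. -/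
def vertexLoc {V : Type} (G : SimpleGraph V) (i : V) :
    SimpleGraph (vertexLocSet G i) :=
  G.induce (vertexLocSet G i)

/-- A graph is unmixed if all its maximal independent sets have the same cardinality. -/
def graphUnmixed {V : Type} (G : SimpleGraph V) : Prop :=
  ∀ F ∈ facets (indepComplex G), ∀ F' ∈ facets (indepComplex G), F.card = F'.card

/-- `G` has no isolated vertices. -/
def noIsolated {V : Type} (G : SimpleGraph V) : Prop :=
  ∀ v : V, ∃ w : V, G.Adj v w

end

section ExtComparison

universe u

lemma mono_homologyMap_of_forall {R : Type u} [Ring R] {S T : ShortComplex (ModuleCat.{u} R)}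
    (φ : S ⟶ T)
    (h : ∀ x : S.X₂, S.g x = 0 → (∃ w, T.f w = φ.τ₂ x) → ∃ w, S.f w = x) :
    Mono (ShortComplex.homologyMap φ) := by
  rw [ModuleCat.mono_iff_injective, injective_iff_map_eq_zero]
  intro x hx
  obtain ⟨z, rfl⟩ := (ModuleCat.epi_iff_surjective S.homologyπ).1 inferInstance x
  have h1 : T.homologyπ (ShortComplex.cyclesMap φ z) = 0 := by
    rw [← hx, ← ConcreteCategory.comp_apply, ← ConcreteCategory.comp_apply]
    simp
  have hex : (ShortComplex.mk T.toCycles T.homologyπ (by simp)).Exact :=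
    ShortComplex.exact_of_g_is_cokernel _ T.homologyIsCokernel
  obtain ⟨w, hw⟩ := (ShortComplex.moduleCat_exact_iff _).1 hex _ h1
  change T.toCycles w = _ at hw
  have h2 : T.f w = φ.τ₂ (S.iCycles z) := by
    have := congrArg T.iCycles hw
    rw [← ConcreteCategory.comp_apply, ← ConcreteCategory.comp_apply] at this
    simpa using this
  obtain ⟨w', hw'⟩ := h (S.iCycles z)
    (by rw [← ConcreteCategory.comp_apply]; simp) ⟨w, h2⟩
  have h3 : S.toCycles w' = z := by
    apply (ModuleCat.mono_iff_injective S.iCycles).1 inferInstance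
    rw [← ConcreteCategory.comp_apply]
    simpa using hw'
  rw [← h3, ← ConcreteCategory.comp_apply]
  simp

variable {R : Type u} [CommRing R]

open Abelian

lemma extMk_zero_eq_zero_iff {X Y : ModuleCat.{u} R} (P : ProjectiveResolution X) {n : ℕ}
    (f : P.complex.X n ⟶ Y) (m : ℕ) (hm : n + 1 = m) (hf : P.complex.d m n ≫ f = 0) :
    P.extMk f m hm hf = 0 ↔ ∃ (j : ℕ) (g : P.complex.X j ⟶ Y), P.complex.d n j ≫ g = f := by
  cases n with
  | succ n =>
    rw [P.extMk_eq_zero_iff f m hm hf n rfl]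
    constructor
    · rintro ⟨g, hg⟩
      exact ⟨n, g, hg⟩
    · rintro ⟨j, g, hg⟩
      by_cases hj : n = j
      · subst hj
        exact ⟨g, hg⟩
      · rw [P.complex.shape _ _ (by simpa using Ne.symm hj)] at hg
        exact ⟨0, by simpa using hg⟩
  | zero =>
    constructor
    · intro h
      refine ⟨0, 0, ?_⟩
      have := congrArg P.extEquivCohomologyClass h
      rw [P.extEquivCohomologyClass_extMk, P.extEquivCohomologyClass_zero,
        CochainComplex.HomComplex.CohomologyClass.mk_eq_zero_iff,
        CochainComplex.HomComplex.Cocycle.toSingleMk_mem_coboundaries_iff _ _ _ _ _ 1 (by lia)] at this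
      obtain ⟨g, hg⟩ := this
      have h0 : P.cochainComplex.d (-(0:ℕ)) 1 = 0 := by
        apply IsZero.eq_of_tgt
        exact CochainComplex.isZero_of_isStrictlyLE _ 0 _ (by lia)
      rw [h0] at hg
      rw [← cancel_epi (P.cochainComplexXIso (-(0 : ℕ)) 0 rfl).hom]
      simpa using hg
    · rintro ⟨j, g, hg⟩
      have : f = 0 := by
        rw [← hg, P.complex.shape _ _ (by simp), zero_comp]
      subst this
      simp


lemma mono_ext_map_of_injective {X X' Y : ModuleCat.{u} R} (g : X' ⟶ X) (n : ℕ)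
    (hg : ∀ e : Abelian.Ext X Y n, (Ext.mk₀ g).comp e (zero_add n) = 0 → e = 0) :
    Mono (((_root_.Ext R (ModuleCat.{u} R) n).map g.op).app Y) := by
  let P' := ProjectiveResolution.of X'
  let P := ProjectiveResolution.of X
  let F := ((linearYoneda R (ModuleCat.{u} R)).obj Y).rightOp
  let φ := ProjectiveResolution.lift g P' P
  have comm : φ.f 0 ≫ P.π.f 0 = P'.π.f 0 ≫ g := ProjectiveResolution.lift_commutes_zero g P' P
  let Φ : ProjectiveResolution.Hom P' P g := ⟨φ, by simpa using comm⟩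
  have key : Mono (ShortComplex.homologyMap (ShortComplex.unopMap
      ((HomologicalComplex.shortComplexFunctor _ _ n).map
        ((F.mapHomologicalComplex _).map φ)))) := by
    apply mono_homologyMap_of_forall
    rintro (x : P.complex.X n ⟶ Y) hx ⟨w, hw⟩
    change P'.complex.X _ ⟶ Y at w
    have hx' : P.complex.d ((ComplexShape.down ℕ).prev n) n ≫ x = 0 := hx
    have hw' : P'.complex.d n ((ComplexShape.down ℕ).next n) ≫ w = φ.f n ≫ x := hw
    have hp : n + 1 = (ComplexShape.down ℕ).prev n := by simp
    have h1 : P.extMk x _ hp hx' = 0 := by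
      apply hg
      rw [ProjectiveResolution.mk₀_comp_extMk x _ hp hx' Φ, extMk_zero_eq_zero_iff]
      exact ⟨_, w, hw'⟩
    rw [extMk_zero_eq_zero_iff] at h1
    obtain ⟨j, v, hv⟩ := h1
    by_cases hj : (ComplexShape.down ℕ).Rel n j
    · obtain rfl := (ComplexShape.down ℕ).next_eq' hj
      exact ⟨v, hv⟩
    · rw [P.complex.shape _ _ hj, zero_comp] at hv
      subst hv
      exact ⟨0, map_zero _⟩
  have : Epi ((F.leftDerived n).map g) := by
    rw [F.leftDerived_map_eq n g φ (by simp [φ])]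
    have : Epi ((F.mapHomologicalComplex (ComplexShape.down ℕ) ⋙ HomologicalComplex.homologyFunctor _ _ n).map φ) := by
      have h1 := ShortComplex.homologyOpIso_hom_naturality (ShortComplex.unopMap
      ((HomologicalComplex.shortComplexFunctor _ _ n).map
        ((F.mapHomologicalComplex (ComplexShape.down ℕ)).map φ)))
      have : Epi (ShortComplex.homologyMap (ShortComplex.unopMap
      ((HomologicalComplex.shortComplexFunctor _ _ n).map
        ((F.mapHomologicalComplex (ComplexShape.down ℕ)).map φ)))).op := inferInstance
      have h2 : Epi (ShortComplex.homologyMap (ShortComplex.opMap (ShortComplex.unopMap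
          ((HomologicalComplex.shortComplexFunctor _ _ n).map
          ((F.mapHomologicalComplex (ComplexShape.down ℕ)).map φ))))) := by
        rw [← Iso.eq_comp_inv] at h1
        rw [h1]
        infer_instance
      exact h2
    infer_instance
  exact inferInstanceAs (Mono ((F.leftDerived n).map g).unop)


lemma subsingleton_ext_iff (X Y : ModuleCat.{u} R) (n : ℕ) :
    Subsingleton (((_root_.Ext R (ModuleCat.{u} R) n).obj (Opposite.op X)).obj Y) ↔
      Subsingleton (Abelian.Ext X Y n) := by
  let P := ProjectiveResolution.of X
  have e := (P.isoExt (R := R) n Y)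
  rw [← ModuleCat.isZero_iff_subsingleton, e.isZero_iff,
    ← HomologicalComplex.exactAt_iff_isZero_homology, HomologicalComplex.exactAt_iff,
    ShortComplex.moduleCat_exact_iff]
  have hp : n + 1 = (ComplexShape.down ℕ).prev n := by simp
  constructor
  · intro h
    refine subsingleton_of_forall_eq 0 fun e ↦ ?_
    obtain ⟨x, hx, rfl⟩ := P.extMk_surjective e _ hp
    obtain ⟨w, hw⟩ := h x hx
    rw [extMk_zero_eq_zero_iff]
    exact ⟨_, w, hw⟩
  · rintro h (x : P.complex.X n ⟶ Y) hx
    have hx' : P.complex.d ((ComplexShape.down ℕ).prev n) n ≫ x = 0 := hx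
    have h1 : P.extMk x _ hp hx' = 0 := Subsingleton.elim _ _
    rw [extMk_zero_eq_zero_iff] at h1
    obtain ⟨j, v, hv⟩ := h1
    by_cases hj : (ComplexShape.down ℕ).Rel n j
    · obtain rfl := (ComplexShape.down ℕ).next_eq' hj
      exact ⟨v, hv⟩
    · rw [P.complex.shape _ _ hj, zero_comp] at hv
      subst hv
      exact ⟨0, map_zero _⟩

end ExtComparison

section DepthTheory

universe u

open Abelian RingTheory.Sequence Pointwise

/-- `Ext^i(R/I, M) = 0` for all `i < d`, i.e. the grade of `I` on `M` is at least `d`. -/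
def GradeGE {R : Type u} [CommRing R] (I : Ideal R) (M : Type u) [AddCommGroup M] [Module R M]
    (d : ℕ) : Prop :=
  ∀ i < d, Subsingleton (Abelian.Ext (ModuleCat.of R (R ⧸ I)) (ModuleCat.of R M) i)

variable {R : Type u} [CommRing R]

lemma subsingleton_ext_of_isWeaklyRegular [IsNoetherianRing R] (I : Ideal R)
    (N : ModuleCat.{u} R) [Nfin : Module.Finite R N]
    (Nsupp : Module.support R N ⊆ PrimeSpectrum.zeroLocus I)
    (M : ModuleCat.{u} R) [Module.Finite R M]
    (rs : List R) (mem : ∀ r ∈ rs, r ∈ I) (reg : IsWeaklyRegular M rs) :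
    ∀ i < rs.length, Subsingleton (Abelian.Ext N M i) := by
  induction rs generalizing M with
  | nil => simp
  | cons a rs ih =>
    intro i hi
    have le_rad := Nsupp
    rw [Module.support_eq_zeroLocus, PrimeSpectrum.zeroLocus_subset_zeroLocus_iff] at le_rad
    obtain ⟨k, hk⟩ := le_rad (mem a List.mem_cons_self)
    simp only [isWeaklyRegular_cons_iff] at reg
    simp only [List.mem_cons, forall_eq_or_imp] at mem
    match i with
    | 0 =>
      have : Subsingleton (N →ₗ[R] M) := IsSMulRegular.subsingleton_linearMap_iff.mpr ⟨a ^ k, hk, reg.1.pow k⟩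
      exact (Ext.addEquiv₀.trans ModuleCat.homAddEquiv).subsingleton
    | i + 1 =>
      let g := (AddCommGrpCat.ofHom ((Ext.mk₀ (ModuleCat.smulShortComplex M a).f).postcomp N
        (add_zero (i + 1))))
      have mono_g : Mono g := by
        apply (Ext.covariant_sequence_exact₁' N reg.1.smulShortComplex_shortExact i (i + 1)
          rfl).mono_g ((AddCommGrpCat.isZero_of_iff_subsingleton.mpr ?_).eq_zero_of_src _)
        exact ih (ModuleCat.of R (QuotSMulTop a M)) mem.2 reg.2 i (by simpa using hi)
      let gk := AddCommGrpCat.ofHom ((Ext.mk₀ (M.smulShortComplex (a ^ k)).f).postcomp N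
        (add_zero (i + 1)))
      have mono_gk : Mono gk := by
        simp only [ModuleCat.smulShortComplex_f_eq_smul_id, g, gk] at mono_g ⊢
        exact (Ext.postcomp_smul_id_mono_iff (a ^ k) (i + 1)).mpr <|
          ((Ext.postcomp_smul_id_mono_iff a (i + 1)).mp mono_g).pow k
      have zero_gk : gk = 0 := Ext.postcomp_smul_id_eq_zero_of_mem_annihilator hk (i + 1)
      exact AddCommGrpCat.subsingleton_of_isZero (IsZero.of_mono_eq_zero _ zero_gk)

lemma GradeGE.mono {I : Ideal R} {M : Type u} [AddCommGroup M] [Module R M] {d e : ℕ}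
    (h : GradeGE I M d) (hde : e ≤ d) : GradeGE I M e :=
  fun i hi ↦ h i (hi.trans_le hde)

lemma GradeGE.quotSMulTop {I : Ideal R} {M : Type u} [AddCommGroup M] [Module R M] {d : ℕ}
    {x : R} (hx : IsSMulRegular M x) (h : GradeGE I M (d + 1)) :
    GradeGE I (QuotSMulTop x M) d := by
  intro i hi
  have zero1 := AddCommGrpCat.isZero_of_iff_subsingleton.mpr (h i (by omega))
  have zero2 := AddCommGrpCat.isZero_of_iff_subsingleton.mpr (h (i + 1) (by omega))
  exact AddCommGrpCat.subsingleton_of_isZero <| ShortComplex.Exact.isZero_of_both_zeros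
    ((Ext.covariant_sequence_exact₃' _ (IsSMulRegular.smulShortComplex_shortExact (M := ModuleCat.of R M) hx)) i (i + 1) rfl)
    (zero1.eq_zero_of_src _) (zero2.eq_zero_of_tgt _)

lemma GradeGE.exists_isSMulRegular [IsNoetherianRing R] {I : Ideal R} {M : Type u} [AddCommGroup M]
    [Module R M] [Module.Finite R M] {d : ℕ} (h : GradeGE I M (d + 1)) :
    ∃ x ∈ I, IsSMulRegular M x := by
  have : Subsingleton (ModuleCat.of R (R ⧸ I) ⟶ ModuleCat.of R M) :=
    Ext.addEquiv₀.subsingleton_congr.mp (h 0 d.zero_lt_succ)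
  have : Subsingleton ((R ⧸ I) →ₗ[R] M) :=
    (ModuleCat.homAddEquiv (M := ModuleCat.of R (R ⧸ I)) (N := ModuleCat.of R M)).symm.subsingleton
  obtain ⟨x, mem_ann, hx⟩ := IsSMulRegular.subsingleton_linearMap_iff.mp this
  exact ⟨x, by rwa [← Ideal.annihilator_quotient (I := I)], hx⟩

lemma gradeGE_zero (I : Ideal R) (M : Type u) [AddCommGroup M] [Module R M] : GradeGE I M 0 :=
  fun i hi ↦ absurd hi (by simp)

lemma support_quotient_subset (I : Ideal R) :
    Module.support R (R ⧸ I) ⊆ PrimeSpectrum.zeroLocus I := by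
  rw [Module.support_eq_zeroLocus, Ideal.annihilator_quotient]

lemma GradeGE.of_isWeaklyRegular [IsNoetherianRing R] {I : Ideal R} {M : Type u} [AddCommGroup M]
    [Module R M] [Module.Finite R M] {rs : List R} (mem : ∀ r ∈ rs, r ∈ I)
    (reg : IsWeaklyRegular M rs) : GradeGE I M rs.length :=
  subsingleton_ext_of_isWeaklyRegular I (ModuleCat.of R (R ⧸ I)) (support_quotient_subset I)
    (ModuleCat.of R M) rs mem reg

lemma GradeGE.exists_isWeaklyRegular [IsNoetherianRing R] {I : Ideal R} {d : ℕ} {M : Type u}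
    [AddCommGroup M] [Module R M] [Module.Finite R M] (h : GradeGE I M d) :
    ∃ rs : List R, rs.length = d ∧ (∀ r ∈ rs, r ∈ I) ∧ IsWeaklyRegular M rs := by
  induction d generalizing M with
  | zero => exact ⟨[], by simp⟩
  | succ d ih =>
    obtain ⟨x, hxI, hx⟩ := h.exists_isSMulRegular
    obtain ⟨rs, len, mem, reg⟩ := ih (h.quotSMulTop hx)
    exact ⟨x :: rs, by simpa [len, hxI] using ⟨mem, hx, reg⟩⟩

lemma gradeGE_succ_of_quotSMulTop [IsNoetherianRing R] {I : Ideal R} {M : Type u} [AddCommGroup M]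
    [Module R M] [Module.Finite R M] {d : ℕ} {x : R} (hxI : x ∈ I) (hx : IsSMulRegular M x)
    (h : GradeGE I (QuotSMulTop x M) d) : GradeGE I M (d + 1) := by
  obtain ⟨rs, rfl, mem, reg⟩ := h.exists_isWeaklyRegular
  exact GradeGE.of_isWeaklyRegular (rs := x :: rs) (by simpa [hxI] using mem) (by simpa using ⟨hx, reg⟩)

lemma GradeGE.subsingleton_ext [IsNoetherianRing R] {I : Ideal R} {M : Type u} [AddCommGroup M]
    [Module R M] [Module.Finite R M] {d : ℕ} (h : GradeGE I M d) (N : ModuleCat.{u} R)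
    [Module.Finite R N] (hN : Module.support R N ⊆ PrimeSpectrum.zeroLocus I) (i : ℕ) (hi : i < d) :
    Subsingleton (Abelian.Ext N (ModuleCat.of R M) i) := by
  obtain ⟨rs, rfl, mem, reg⟩ := h.exists_isWeaklyRegular
  exact subsingleton_ext_of_isWeaklyRegular I N hN (ModuleCat.of R M) rs mem reg i hi

lemma gradeGE_pi_iff {I : Ideal R} {ι : Type} [Finite ι] (M : ι → Type u)
    [∀ j, AddCommGroup (M j)] [∀ j, Module R (M j)] {d : ℕ} :
    GradeGE I (∀ j, M j) d ↔ ∀ j, GradeGE I (M j) d := by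
  classical
  cases nonempty_fintype ι
  constructor
  · intro h j i hi
    have := h i hi
    refine subsingleton_of_forall_eq 0 fun x ↦ ?_
    have h1 : x.comp (Ext.mk₀ (ModuleCat.ofHom (LinearMap.single R M j))) (add_zero i) = 0 :=
      Subsingleton.elim _ _
    have h2 : (x.comp (Ext.mk₀ (ModuleCat.ofHom (LinearMap.single R M j))) (add_zero i)).comp
        (Ext.mk₀ (ModuleCat.ofHom (LinearMap.proj j))) (add_zero i) = 0 := by
      rw [h1]; simp
    rw [Ext.comp_assoc_of_third_deg_zero, Ext.mk₀_comp_mk₀] at h2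
    have h3 : ModuleCat.ofHom (LinearMap.single R M j) ≫
        ModuleCat.ofHom (LinearMap.proj j) = 𝟙 (ModuleCat.of R (M j)) := by
      ext x; simp
    simpa [h3] using h2
  · intro h i hi
    refine subsingleton_of_forall_eq 0 fun x ↦ ?_
    have h3 : 𝟙 (ModuleCat.of R (∀ j, M j)) =
        ∑ j, (ModuleCat.ofHom (LinearMap.proj j : (∀ j, M j) →ₗ[R] M j) ≫
          ModuleCat.ofHom (LinearMap.single R M j)) := by
      ext x j
      simp [ModuleCat.hom_sum, Finset.sum_apply]
    have h4 : x = x.comp (Ext.mk₀ (𝟙 (ModuleCat.of R (∀ j, M j)))) (add_zero i) := by simp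
    rw [h4, h3, Ext.mk₀_sum, Ext.comp_sum]
    refine Finset.sum_eq_zero fun j _ ↦ ?_
    have := h j i hi
    rw [← Ext.mk₀_comp_mk₀, ← Ext.comp_assoc_of_third_deg_zero,
      Subsingleton.elim (x.comp (Ext.mk₀ (ModuleCat.ofHom (LinearMap.proj j))) (add_zero i)) 0]
    simp

lemma gradeGE_of_shortExact {I : Ideal R} {A B C : Type u} [AddCommGroup A] [Module R A]
    [AddCommGroup B] [Module R B] [AddCommGroup C] [Module R C] (f : A →ₗ[R] B) (g : B →ₗ[R] C)
    (hf : Function.Injective f) (hg : Function.Surjective g) (hfg : Function.Exact f g) {d : ℕ}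
    (hB : GradeGE I B (d + 1)) (hC : GradeGE I C d) : GradeGE I A (d + 1) := by
  have hS := ModuleCat.shortComplex_shortExact
    (ShortComplex.mk (ModuleCat.ofHom f) (ModuleCat.ofHom g) (by ext x; exact hfg.apply_apply_eq_zero x)) hfg hf hg
  intro i hi
  have h1 := hB i hi
  refine subsingleton_of_forall_eq 0 fun x ↦ ?_
  match i with
  | 0 =>
    have := hS.mono_f
    exact Ext.postcomp_mk₀_injective_of_mono (ModuleCat.of R (R ⧸ I)) (ModuleCat.ofHom f)
      (Subsingleton.elim _ _)
  | i + 1 =>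
    obtain ⟨y, hy⟩ := Ext.covariant_sequence_exact₁ _ hS x (Subsingleton.elim _ _) (n₀ := i) rfl
    have := hC i (by omega)
    rw [← hy, Subsingleton.elim y 0]
    simp

lemma gradeGE_right_of_shortExact {I : Ideal R} {A B C : Type u} [AddCommGroup A] [Module R A]
    [AddCommGroup B] [Module R B] [AddCommGroup C] [Module R C] (f : A →ₗ[R] B) (g : B →ₗ[R] C)
    (hf : Function.Injective f) (hg : Function.Surjective g) (hfg : Function.Exact f g) {d : ℕ}
    (hB : GradeGE I B d) (hA : GradeGE I A (d + 1)) : GradeGE I C d := by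
  have hS := ModuleCat.shortComplex_shortExact
    (ShortComplex.mk (ModuleCat.ofHom f) (ModuleCat.ofHom g) (by ext x; exact hfg.apply_apply_eq_zero x)) hfg hf hg
  intro i hi
  have h1 := hB i hi
  have h2 := hA (i + 1) (by omega)
  refine subsingleton_of_forall_eq 0 fun x ↦ ?_
  obtain ⟨y, hy⟩ := Ext.covariant_sequence_exact₃ _ hS x rfl (Subsingleton.elim _ _)
  rw [← hy, Subsingleton.elim y 0]
  simp


section BaseChange

variable {A B : Type u} [CommRing A] [CommRing B] {M N : Type u} [AddCommGroup M] [Module A M]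
  [AddCommGroup N] [Module B N]

/-- Quotients by a regular element correspond under a semilinear additive equivalence. -/
def quotSMulTopAddEquiv (φ : A →+* B) (e : M ≃+ N) (he : ∀ a m, e (a • m) = φ a • e m) (x : A) :
    QuotSMulTop x M ≃+ QuotSMulTop (φ x) N :=
  QuotientAddGroup.congr _ _ e <| by
    ext n
    simp only [AddSubgroup.mem_map, Submodule.mem_toAddSubgroup,
      Submodule.mem_smul_pointwise_iff_exists, Submodule.mem_top, true_and]
    constructor
    · rintro ⟨_, ⟨m, rfl⟩, rfl⟩
      exact ⟨e m, (he x m).symm⟩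
    · rintro ⟨n, rfl⟩
      exact ⟨x • e.symm n, ⟨_, rfl⟩, by simp [he]⟩

lemma quotSMulTopAddEquiv_smul (φ : A →+* B) (e : M ≃+ N) (he : ∀ a m, e (a • m) = φ a • e m)
    (x a : A) (m : QuotSMulTop x M) :
    quotSMulTopAddEquiv (M := M) (N := N) φ e he x (a • m) = φ a • quotSMulTopAddEquiv (M := M) (N := N) φ e he x m := by
  obtain ⟨m, rfl⟩ := Submodule.mkQ_surjective _ m
  exact congrArg (Submodule.mkQ (φ x • (⊤ : Submodule B N))) (he a m : e (a • m) = φ a • e m)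

theorem gradeGE_iff_of_semilinear [IsNoetherianRing A] [IsNoetherianRing B] [Module.Finite A M]
    [Module.Finite B N] (φ : A →+* B) (e : M ≃+ N) (he : ∀ a m, e (a • m) = φ a • e m)
    {I : Ideal A} {J : Ideal B} (h1 : I.map φ ≤ J) (h2 : J ≤ (I.map φ).radical) {d : ℕ} :
    GradeGE I M d ↔ GradeGE J N d := by
  constructor
  · intro h
    obtain ⟨rs, rfl, mem, reg⟩ := h.exists_isWeaklyRegular
    have : IsWeaklyRegular N (rs.map φ) := by
      refine (AddEquiv.isWeaklyRegular_congr (e := e) ?_).1 reg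
      exact List.forall₂_map_right_iff.mpr <| List.forall₂_same.mpr fun r _ x ↦ he r x
    rw [← List.length_map (as := rs) φ]
    refine GradeGE.of_isWeaklyRegular ?_ this
    simp only [List.mem_map, forall_exists_index, and_imp, forall_apply_eq_imp_iff₂]
    exact fun r hr ↦ h1 (Ideal.mem_map_of_mem _ (mem r hr))
  · intro h
    induction d generalizing M N with
    | zero => exact gradeGE_zero _ _
    | succ d ih =>
      obtain ⟨y, hyJ, hy⟩ := h.exists_isSMulRegular
      obtain ⟨n, hn⟩ := h2 hyJ
      have hreg : ∃ x ∈ I, IsSMulRegular M x := by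
        have : Subsingleton ((A ⧸ I) →ₗ[A] M) := by
          refine subsingleton_of_forall_eq 0 fun f ↦ ?_
          have hf : ∀ b ∈ I.map φ, b • e (f 1) = 0 := by
            intro b hb
            have : I.map φ ≤ (Submodule.span B {e (f 1)}).annihilator := by
              rw [Ideal.map_le_iff_le_comap]
              intro a ha
              rw [Ideal.mem_comap, Submodule.mem_annihilator_span_singleton, ← he, ← map_smul]
              have : a • (1 : A ⧸ I) = 0 := by
                rw [Algebra.smul_def, mul_one]
                exact Ideal.Quotient.eq_zero_iff_mem.2 ha
              rw [this, map_zero, map_zero]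
            exact (Submodule.mem_annihilator_span_singleton _ _).1 (this hb)
          have h0 : e (f 1) = 0 := (hy.pow n) (by simpa using hf _ hn)
          ext
          simpa using h0
        obtain ⟨x, mem_ann, hx⟩ := IsSMulRegular.subsingleton_linearMap_iff.mp this
        exact ⟨x, by rwa [← Ideal.annihilator_quotient (I := I)], hx⟩
      obtain ⟨x, hxI, hx⟩ := hreg
      have hx' : IsSMulRegular N (φ x) := (Equiv.isSMulRegular_congr (e := e.toEquiv) (he x)).1 hx
      exact gradeGE_succ_of_quotSMulTop hxI hx
        (ih (quotSMulTopAddEquiv φ e he x) (quotSMulTopAddEquiv_smul φ e he x)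
          (h.quotSMulTop hx'))

end BaseChange

end DepthTheory

section LocalCohomologyGrade

open Abelian

variable {R : Type} [CommRing R]

/-- The component at `M` of the direct system defining local cohomology. -/
noncomputable abbrev locCohSystem (I : Ideal R) (i : ℕ) (M : ModuleCat.{0} R) :
    ℕᵒᵖᵒᵖ ⥤ ModuleCat.{0} R :=
  localCohomology.diagram (localCohomology.idealPowersDiagram I) i ⋙ (evaluation _ _).obj M

/-- Local cohomology is computed by a colimit of modules. -/
noncomputable def localCohomologyObjIso (I : Ideal R) (i : ℕ) (M : ModuleCat.{0} R) :
    (localCohomology I i).obj M ≅ colimit (locCohSystem I i M) :=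
  colimitObjIsoColimitCompEvaluation _ M

lemma support_quotient_pow_subset (I : Ideal R) (n : ℕ) :
    Module.support R (R ⧸ I ^ n) ⊆ PrimeSpectrum.zeroLocus I := by
  refine (support_quotient_subset _).trans ?_
  rw [PrimeSpectrum.zeroLocus_subset_zeroLocus_iff]
  rcases n with - | n
  · simp [Ideal.radical_top]
  · simp only [I.radical_pow n.succ_ne_zero, Ideal.le_radical]

lemma subsingleton_localCohomology_of_gradeGE [IsNoetherianRing R] {I : Ideal R} {M : Type}
    [AddCommGroup M] [Module R M] [Module.Finite R M] {d i : ℕ} (h : GradeGE I M d) (hi : i < d) :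
    Subsingleton ((localCohomology I i).obj (ModuleCat.of R M)) := by
  rw [← ModuleCat.isZero_iff_subsingleton, (localCohomologyObjIso I i _).isZero_iff,
    ModuleCat.isZero_iff_subsingleton]
  refine subsingleton_of_forall_eq 0 fun x ↦ ?_
  obtain ⟨j, y, rfl⟩ := Concrete.colimit_exists_rep _ x
  have : Subsingleton ((locCohSystem I i (ModuleCat.of R M)).obj j) := by
    refine (subsingleton_ext_iff (ModuleCat.of R (R ⧸ I ^ j.unop.unop)) (ModuleCat.of R M) i).2 ?_
    exact h.subsingleton_ext (ModuleCat.of R (R ⧸ I ^ j.unop.unop))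
      (support_quotient_pow_subset I _) i hi
  rw [Subsingleton.elim y 0]
  exact map_zero _

lemma mono_locCohSystem_map [IsNoetherianRing R] {I : Ideal R} {M : Type}
    [AddCommGroup M] [Module R M] [Module.Finite R M] {i : ℕ} (h : GradeGE I M i)
    {j k : ℕᵒᵖᵒᵖ} (f : j ⟶ k) : Mono ((locCohSystem I i (ModuleCat.of R M)).map f) := by
  let g : (R ⧸ I ^ k.unop.unop) →ₗ[R] R ⧸ I ^ j.unop.unop :=
    ((localCohomology.ringModIdeals (localCohomology.idealPowersDiagram I)).map f.unop).hom
  have hg : Function.Surjective g := by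
    intro x
    obtain ⟨x, rfl⟩ := Submodule.mkQ_surjective _ x
    exact ⟨Submodule.mkQ _ x, rfl⟩
  refine mono_ext_map_of_injective (Y := ModuleCat.of R M) (ModuleCat.ofHom g) i fun e he ↦ ?_
  have hS := ModuleCat.shortComplex_shortExact
    (ShortComplex.mk (ModuleCat.ofHom (LinearMap.ker g).subtype) (ModuleCat.ofHom g)
      (by ext x; exact x.2)) (LinearMap.exact_subtype_ker_map g) Subtype.val_injective hg
  match i with
  | 0 =>
    have := hS.epi_g
    obtain ⟨e, rfl⟩ := Ext.addEquiv₀.symm.surjective e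
    simp only [Ext.addEquiv₀_symm_apply, Ext.mk₀_comp_mk₀, Ext.mk₀_eq_zero_iff] at he ⊢
    rw [← cancel_epi (ModuleCat.ofHom g), he, Limits.comp_zero]
  | i + 1 =>
    obtain ⟨y, hy⟩ := Ext.contravariant_sequence_exact₃ hS _ e he (add_comm 1 i)
    have : Subsingleton (Abelian.Ext (ModuleCat.of R (LinearMap.ker g)) (ModuleCat.of R M) i) :=
      h.subsingleton_ext (ModuleCat.of R (LinearMap.ker g))
        ((Module.support_subset_of_injective (LinearMap.ker g).subtype Subtype.val_injective).trans
          (support_quotient_pow_subset I _)) i (by omega)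
    rw [← hy, Subsingleton.elim y 0]
    simp

theorem gradeGE_iff_localCohomology [IsNoetherianRing R] {I : Ideal R} {M : Type}
    [AddCommGroup M] [Module R M] [Module.Finite R M] {d : ℕ} :
    GradeGE I M d ↔ ∀ i < d, Subsingleton ((localCohomology I i).obj (ModuleCat.of R M)) := by
  refine ⟨fun h i hi ↦ subsingleton_localCohomology_of_gradeGE h hi, fun h ↦ ?_⟩
  induction d with
  | zero => exact gradeGE_zero _ _
  | succ d ih =>
    have hd := ih fun i hi ↦ h i (by omega)
    intro i hi
    rcases Nat.lt_succ_iff_lt_or_eq.1 hi with hi | rfl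
    · exact hd i hi
    have hc := h i hi
    rw [← ModuleCat.isZero_iff_subsingleton, (localCohomologyObjIso I i _).isZero_iff,
      ModuleCat.isZero_iff_subsingleton] at hc
    let j₁ : ℕᵒᵖᵒᵖ := Opposite.op (Opposite.op 1)
    have h1 : Subsingleton ((locCohSystem I i (ModuleCat.of R M)).obj j₁) := by
      refine subsingleton_of_forall_eq 0 fun x ↦ ?_
      obtain ⟨k, f, g, hfg⟩ := Concrete.colimit_exists_of_rep_eq (locCohSystem I i (ModuleCat.of R M))
        x (0 : (locCohSystem I i (ModuleCat.of R M)).obj j₁) (Subsingleton.elim _ _)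
      have := mono_locCohSystem_map hd f
      rw [ModuleCat.mono_iff_injective] at this
      apply this
      rw [hfg, map_zero, map_zero]
    have h2 := (subsingleton_ext_iff (ModuleCat.of R (R ⧸ I ^ 1)) (ModuleCat.of R M) i).1 h1
    rwa [pow_one] at h2

end LocalCohomologyGrade

section IdealQuotients

universe u

lemma GradeGE.prod {R : Type u} [CommRing R] {I : Ideal R} {A B : Type u} [AddCommGroup A]
    [Module R A] [AddCommGroup B] [Module R B] {d : ℕ} (hA : GradeGE I A d) (hB : GradeGE I B d) :
    GradeGE I (A × B) d := by
  intro i hi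
  have := hA i hi
  have := hB i hi
  refine subsingleton_of_forall_eq 0 fun x ↦ ?_
  have h3 : 𝟙 (ModuleCat.of R (A × B)) =
      ModuleCat.ofHom (LinearMap.fst R A B) ≫ ModuleCat.ofHom (LinearMap.inl R A B) +
        ModuleCat.ofHom (LinearMap.snd R A B) ≫ ModuleCat.ofHom (LinearMap.inr R A B) := by
    ext x <;> simp
  have h4 : x = x.comp (Abelian.Ext.mk₀ (𝟙 (ModuleCat.of R (A × B)))) (add_zero i) := by simp
  rw [h4, h3, Abelian.Ext.mk₀_add, Abelian.Ext.comp_add, ← Abelian.Ext.mk₀_comp_mk₀,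
    ← Abelian.Ext.mk₀_comp_mk₀, ← Abelian.Ext.comp_assoc_of_third_deg_zero,
    ← Abelian.Ext.comp_assoc_of_third_deg_zero,
    Subsingleton.elim (x.comp (Abelian.Ext.mk₀ (ModuleCat.ofHom (LinearMap.fst R A B))) _) 0,
    Subsingleton.elim (x.comp (Abelian.Ext.mk₀ (ModuleCat.ofHom (LinearMap.snd R A B))) _) 0]
  simp

lemma GradeGE.of_subsingleton {R : Type u} [CommRing R] {I : Ideal R} {A : Type u} [AddCommGroup A]
    [Module R A] [Subsingleton A] (d : ℕ) : GradeGE I A d := by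
  intro i hi
  refine subsingleton_of_forall_eq 0 fun x ↦ ?_
  have h3 : 𝟙 (ModuleCat.of R A) = 0 := by
    ext x
    exact Subsingleton.elim (α := A) _ _
  have h4 : x = x.comp (Abelian.Ext.mk₀ (𝟙 (ModuleCat.of R A))) (add_zero i) := by simp
  rw [h4, h3]
  simp

variable {R : Type u} [CommRing R] {𝔪 I J : Ideal R} {d : ℕ}

/-- The first map of the sequence `0 → R/(I ∩ J) → R/I × R/J → R/(I + J) → 0`. -/
def quotInfToProd (I J : Ideal R) : (R ⧸ (I ⊓ J)) →ₗ[R] (R ⧸ I) × (R ⧸ J) :=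
  (Submodule.factor inf_le_left).prod (Submodule.factor inf_le_right)

/-- The second map of the sequence `0 → R/(I ∩ J) → R/I × R/J → R/(I + J) → 0`. -/
def quotProdToSup (I J : Ideal R) : (R ⧸ I) × (R ⧸ J) →ₗ[R] (R ⧸ (I ⊔ J)) :=
  (Submodule.factor le_sup_left).comp (LinearMap.fst R _ _) -
    (Submodule.factor le_sup_right).comp (LinearMap.snd R _ _)

lemma quotInfToProd_injective : Function.Injective (quotInfToProd I J) := by
  rw [injective_iff_map_eq_zero]
  intro x hx
  obtain ⟨x, rfl⟩ := Submodule.mkQ_surjective _ x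
  have h1 : Submodule.Quotient.mk (p := I) x = 0 := congrArg Prod.fst hx
  have h2 : Submodule.Quotient.mk (p := J) x = 0 := congrArg Prod.snd hx
  rw [Submodule.Quotient.mk_eq_zero] at h1 h2
  exact (Submodule.Quotient.mk_eq_zero _).2 ⟨h1, h2⟩

lemma quotProdToSup_surjective : Function.Surjective (quotProdToSup I J) := by
  intro x
  obtain ⟨x, rfl⟩ := Submodule.mkQ_surjective _ x
  refine ⟨(Submodule.mkQ _ x, 0), ?_⟩
  change Submodule.factor (le_sup_left : I ≤ I ⊔ J) (Submodule.mkQ _ x) -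
    Submodule.factor (le_sup_right : J ≤ I ⊔ J) 0 = _
  rw [map_zero, sub_zero]
  rfl

lemma quotInfToProd_exact : Function.Exact (quotInfToProd I J) (quotProdToSup I J) := by
  rintro ⟨x, y⟩
  obtain ⟨x, rfl⟩ := Submodule.mkQ_surjective _ x
  obtain ⟨y, rfl⟩ := Submodule.mkQ_surjective _ y
  constructor
  · intro h
    have h : Submodule.Quotient.mk (p := I ⊔ J) (x - y) = 0 := h
    rw [Submodule.Quotient.mk_eq_zero, Submodule.mem_sup] at h
    obtain ⟨a, ha, b, hb, hab⟩ := h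
    refine ⟨Submodule.mkQ _ (x - a), Prod.ext ?_ ?_⟩
    · refine (Submodule.Quotient.eq I).2 ?_
      simpa using ha
    · refine (Submodule.Quotient.eq J).2 ?_
      change x - a - y ∈ J
      rwa [show x - a - y = b by rw [sub_right_comm, ← hab]; ring]
  · rintro ⟨z, hz⟩
    obtain ⟨z, rfl⟩ := Submodule.mkQ_surjective _ z
    rw [← hz]
    change Submodule.Quotient.mk (p := I ⊔ J) (z - z) = 0
    simp

lemma gradeGE_quotient_inf (hI : GradeGE 𝔪 (R ⧸ I) (d + 1)) (hJ : GradeGE 𝔪 (R ⧸ J) (d + 1))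
    (hIJ : GradeGE 𝔪 (R ⧸ (I ⊔ J)) d) : GradeGE 𝔪 (R ⧸ (I ⊓ J)) (d + 1) :=
  gradeGE_of_shortExact (quotInfToProd I J) (quotProdToSup I J) quotInfToProd_injective
    quotProdToSup_surjective quotInfToProd_exact (GradeGE.prod hI hJ) hIJ

lemma gradeGE_quotient_sup (hI : GradeGE 𝔪 (R ⧸ I) d) (hJ : GradeGE 𝔪 (R ⧸ J) d)
    (hIJ : GradeGE 𝔪 (R ⧸ (I ⊓ J)) (d + 1)) : GradeGE 𝔪 (R ⧸ (I ⊔ J)) d :=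
  gradeGE_right_of_shortExact (quotInfToProd I J) (quotProdToSup I J) quotInfToProd_injective
    quotProdToSup_surjective quotInfToProd_exact (GradeGE.prod hI hJ) hIJ

lemma exists_addEquiv_of_ker_eq {G H K : Type*} [AddCommGroup G] [AddCommGroup H] [AddCommGroup K]
    (f : G →+ H) (g : G →+ K) (hf : Function.Surjective f) (hg : Function.Surjective g)
    (h : ∀ x, f x = 0 ↔ g x = 0) : ∃ e : H ≃+ K, ∀ x, e (f x) = g x := by
  have hk : f.ker = g.ker := by
    ext x
    simpa using h x
  refine ⟨(QuotientAddGroup.quotientKerEquivOfSurjective f hf).symm.trans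
    ((QuotientAddGroup.quotientAddEquivOfEq hk).trans
      (QuotientAddGroup.quotientKerEquivOfSurjective g hg)), fun x ↦ ?_⟩
  have : (QuotientAddGroup.quotientKerEquivOfSurjective f hf).symm (f x) = QuotientAddGroup.mk x := by
    rw [AddEquiv.symm_apply_eq]
    rfl
  simp only [AddEquiv.trans_apply, this]
  rfl

/-- Grade transfer between two quotients of a module `G`, along a ring homomorphism `φ`. -/
lemma gradeGE_iff_of_surjective {A B : Type u} [CommRing A] [CommRing B] [IsNoetherianRing A]
    [IsNoetherianRing B] {G : Type*} {M N : Type u} [AddCommGroup G] [Module A G] [AddCommGroup M]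
    [Module A M] [Module.Finite A M] [AddCommGroup N] [Module B N] [Module.Finite B N]
    (φ : A →+* B) (f : G →ₗ[A] M) (g : G →+ N) (hf : Function.Surjective f)
    (hg : Function.Surjective g) (h : ∀ x, f x = 0 ↔ g x = 0)
    (hgφ : ∀ a x, g (a • x) = φ a • g x) {𝔞 : Ideal A} {𝔟 : Ideal B} (h1 : 𝔞.map φ ≤ 𝔟)
    (h2 : 𝔟 ≤ (𝔞.map φ).radical) {d : ℕ} : GradeGE 𝔞 M d ↔ GradeGE 𝔟 N d := by
  obtain ⟨e, he⟩ := exists_addEquiv_of_ker_eq f.toAddMonoidHom g hf hg h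
  refine gradeGE_iff_of_semilinear φ e (fun a m ↦ ?_) h1 h2
  obtain ⟨x, rfl⟩ := hf m
  rw [← map_smul]
  exact (he _).trans ((hgφ a x).trans (congrArg _ (he x).symm))

open Pointwise in
lemma gradeGE_succ_iff_sup_span_singleton [IsNoetherianRing R] {x : R} (hx𝔪 : x ∈ 𝔪)
    (hx : ∀ y, x * y ∈ I → y ∈ I) :
    GradeGE 𝔪 (R ⧸ I) (d + 1) ↔ GradeGE 𝔪 (R ⧸ (I ⊔ Ideal.span {x})) d := by
  have hreg : IsSMulRegular (R ⧸ I) x := by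
    rw [isSMulRegular_iff_right_eq_zero_of_smul]
    intro y hy
    obtain ⟨y, rfl⟩ := Submodule.mkQ_surjective _ y
    exact (Submodule.Quotient.mk_eq_zero _).2 (hx y ((Submodule.Quotient.mk_eq_zero _).1 hy))
  have key : GradeGE 𝔪 (QuotSMulTop x (R ⧸ I)) d ↔ GradeGE 𝔪 (R ⧸ (I ⊔ Ideal.span {x})) d := by
    refine gradeGE_iff_of_surjective (G := R) (RingHom.id R)
      ((Submodule.mkQ (x • (⊤ : Submodule R (R ⧸ I)))).comp (Submodule.mkQ I))
      (Submodule.mkQ (I ⊔ Ideal.span {x})).toAddMonoidHom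
      ((Submodule.mkQ_surjective _).comp (Submodule.mkQ_surjective _))
      (Submodule.mkQ_surjective _) (fun y ↦ ?_) (fun a y ↦ rfl)
      (𝔞 := 𝔪) (𝔟 := 𝔪) (by simp) (by simpa using Ideal.le_radical)
    refine (Submodule.Quotient.mk_eq_zero _).trans (Iff.trans ?_ (Submodule.Quotient.mk_eq_zero _).symm)
    rw [Submodule.mem_smul_pointwise_iff_exists, Submodule.mem_sup]
    constructor
    · rintro ⟨z, -, hz⟩
      obtain ⟨z, rfl⟩ := Submodule.mkQ_surjective _ z
      exact ⟨y - x * z, (Submodule.Quotient.eq I).1 hz.symm, x * z,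
        Ideal.mul_mem_right _ _ (Ideal.mem_span_singleton_self x), by ring⟩
    · rintro ⟨a, ha, b, hb, rfl⟩
      obtain ⟨z, rfl⟩ := Ideal.mem_span_singleton'.1 hb
      refine ⟨Submodule.mkQ _ z, trivial, (Submodule.Quotient.eq I).2 ?_⟩
      have : x * z - (a + z * x) = -a := by ring
      change x * z - (a + z * x) ∈ I
      rw [this]
      exact I.neg_mem ha
  rw [← key]
  exact ⟨fun h ↦ h.quotSMulTop hreg, gradeGE_succ_of_quotSMulTop hx𝔪 hreg⟩

end IdealQuotients

noncomputable section MonomialIdeals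

variable (K : Type) [Field K] {V : Type}

/-- The monomial ideal spanned by the monomials whose exponents lie outside `L`. -/
def monIdeal (L : LowerSet (V →₀ ℕ)) : Ideal (MvPolynomial V K) :=
  Ideal.span ((fun s ↦ monomial s (1 : K)) '' {m | m ∉ L})

variable {K}

lemma mem_monIdeal {L : LowerSet (V →₀ ℕ)} {p : MvPolynomial V K} :
    p ∈ monIdeal K L ↔ ∀ m, coeff m p ≠ 0 → m ∉ L := by
  rw [monIdeal, mem_ideal_span_monomial_image]
  refine forall_congr' fun m ↦ ?_
  rw [mem_support_iff]
  refine imp_congr_right fun _ ↦ ⟨?_, fun h ↦ ⟨m, h, le_rfl⟩⟩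
  rintro ⟨s, hs, hsm⟩ hm
  exact hs (L.lower hsm hm)

lemma monIdeal_sup (L M : LowerSet (V →₀ ℕ)) :
    monIdeal K (L ⊔ M) = monIdeal K L ⊓ monIdeal K M := by
  ext p
  simp only [Submodule.mem_inf, mem_monIdeal, LowerSet.mem_sup_iff, not_or]
  exact ⟨fun h ↦ ⟨fun m hm ↦ (h m hm).1, fun m hm ↦ (h m hm).2⟩,
    fun h m hm ↦ ⟨h.1 m hm, h.2 m hm⟩⟩

lemma monIdeal_inf (L M : LowerSet (V →₀ ℕ)) :
    monIdeal K (L ⊓ M) = monIdeal K L ⊔ monIdeal K M := by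
  rw [monIdeal, monIdeal, monIdeal, ← Ideal.span_union, ← Set.image_union]
  congr 2
  ext m
  simp only [LowerSet.mem_inf_iff, Set.mem_ofPred_eq, Set.mem_union]
  tauto

lemma monIdeal_bot : monIdeal K (⊥ : LowerSet (V →₀ ℕ)) = ⊤ := by
  ext p
  simp [mem_monIdeal]

variable (K)

/-- The quotient by the monomial ideal of `L` has depth at least `d` (at the irrelevant ideal). -/
def MonGrade (L : LowerSet (V →₀ ℕ)) (d : ℕ) : Prop :=
  GradeGE (maxIdeal K V) (MvPolynomial V K ⧸ monIdeal K L) d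

variable {K} {L M : LowerSet (V →₀ ℕ)} {d : ℕ}

lemma MonGrade.mono {e : ℕ} (h : MonGrade K L d) (hde : e ≤ d) : MonGrade K L e :=
  GradeGE.mono h hde

lemma monGrade_zero : MonGrade K L 0 := gradeGE_zero _ _

lemma monGrade_bot : MonGrade K (⊥ : LowerSet (V →₀ ℕ)) d := by
  have : Subsingleton (MvPolynomial V K ⧸ monIdeal K (⊥ : LowerSet (V →₀ ℕ))) := by
    rw [monIdeal_bot]
    infer_instance
  exact GradeGE.of_subsingleton d

lemma MonGrade.sup (hL : MonGrade K L (d + 1)) (hM : MonGrade K M (d + 1))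
    (h : MonGrade K (L ⊓ M) d) : MonGrade K (L ⊔ M) (d + 1) := by
  rw [MonGrade, monIdeal_inf] at h
  rw [MonGrade, monIdeal_sup]
  exact gradeGE_quotient_inf hL hM h

lemma MonGrade.inf (hL : MonGrade K L d) (hM : MonGrade K M d)
    (h : MonGrade K (L ⊔ M) (d + 1)) : MonGrade K (L ⊓ M) d := by
  rw [MonGrade, monIdeal_sup] at h
  rw [MonGrade, monIdeal_inf]
  exact gradeGE_quotient_sup hL hM h

/-- The exponent vector of a squarefree monomial. -/
def sqfreeExp (σ : Finset V) : V →₀ ℕ := Finsupp.indicator σ fun _ _ ↦ 1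

lemma sqfreeExp_apply [DecidableEq V] (σ : Finset V) (i : V) :
    sqfreeExp σ i = if i ∈ σ then 1 else 0 := by
  simp [sqfreeExp, Finsupp.indicator_apply]

/-- The exponents `b` such that `1_σ + 2b` lies in `L`. -/
def frobeniusPart (L : LowerSet (V →₀ ℕ)) (σ : Finset V) : LowerSet (V →₀ ℕ) where
  carrier := {b | sqfreeExp σ + 2 • b ∈ L}
  lower' := fun _ _ hba ha ↦ L.lower (add_le_add_right (nsmul_le_nsmul_right hba 2) _) ha

lemma mem_frobeniusPart {σ : Finset V} {b : V →₀ ℕ} :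
    b ∈ frobeniusPart L σ ↔ sqfreeExp σ + 2 • b ∈ L := Iff.rfl

section Frobenius

lemma map_expand_maxIdeal_le : (maxIdeal K V).map (expand 2 : MvPolynomial V K →ₐ[K] _).toRingHom ≤
    maxIdeal K V := by
  rw [maxIdeal, Ideal.map_span, Ideal.span_le]
  rintro _ ⟨_, ⟨i, rfl⟩, rfl⟩
  change expand 2 (X i : MvPolynomial V K) ∈ _
  rw [expand_X]
  exact Ideal.pow_mem_of_mem _ (Ideal.subset_span (Set.mem_range_self i)) 2 two_pos

lemma maxIdeal_le_radical_map_expand : maxIdeal K V ≤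
    ((maxIdeal K V).map (expand 2 : MvPolynomial V K →ₐ[K] _).toRingHom).radical := by
  rw [maxIdeal, Ideal.span_le]
  rintro _ ⟨i, rfl⟩
  refine ⟨2, ?_⟩
  have := Ideal.mem_map_of_mem (expand 2 : MvPolynomial V K →ₐ[K] MvPolynomial V K).toRingHom
    (Ideal.subset_span ⟨i, rfl⟩ : X i ∈ Ideal.span (Set.range (X : V → MvPolynomial V K)))
  change expand 2 (X i : MvPolynomial V K) ∈ _ at this
  rwa [expand_X] at this

variable [Fintype V] [DecidableEq V]

/-- Assemble a polynomial from its parts of prescribed parity pattern. -/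
def frobeniusSum (K V : Type) [Field K] [Fintype V] [DecidableEq V] :
    (Finset V → MvPolynomial V K) →+ MvPolynomial V K :=
  ∑ σ, ((AddMonoidHom.mulLeft (monomial (sqfreeExp σ) (1 : K))).comp
    (expand 2 : MvPolynomial V K →ₐ[K] MvPolynomial V K).toRingHom.toAddMonoidHom).comp
      (Pi.evalAddMonoidHom _ σ)

lemma frobeniusSum_apply (g : Finset V → MvPolynomial V K) :
    frobeniusSum K V g = ∑ σ, monomial (sqfreeExp σ) 1 * expand 2 (g σ) := by
  rw [frobeniusSum, AddMonoidHom.finsetSum_apply]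
  rfl

lemma coeff_frobeniusSum (g : Finset V → MvPolynomial V K) (σ : Finset V) (b : V →₀ ℕ) :
    coeff (sqfreeExp σ + 2 • b) (frobeniusSum K V g) = coeff b (g σ) := by
  rw [frobeniusSum_apply, coeff_sum, Finset.sum_eq_single σ]
  · rw [coeff_monomial_mul, one_mul, coeff_expand_smul 2 two_ne_zero]
  · intro τ _ hτ
    rw [coeff_monomial_mul']
    split_ifs with h
    · obtain ⟨i, hi⟩ : ∃ i, ¬ (i ∈ τ ↔ i ∈ σ) := by
        by_contra! hc
        exact hτ (Finset.ext hc)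
      rw [coeff_expand_of_not_dvd (i := i), mul_zero]
      have h1 := h i
      simp only [Finsupp.tsub_apply, Finsupp.add_apply, Finsupp.smul_apply, sqfreeExp_apply,
        smul_eq_mul] at h1 ⊢
      by_cases h2 : i ∈ τ <;> by_cases h3 : i ∈ σ <;> (simp [h2, h3] at hi h1 ⊢ <;> omega)
    · rfl
  · simp

lemma exists_eq_sqfreeExp_add (m : V →₀ ℕ) : ∃ σ b, m = sqfreeExp σ + 2 • b := by
  refine ⟨Finset.univ.filter fun i ↦ m i % 2 = 1, m.mapRange (· / 2) rfl, ?_⟩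
  ext i
  simp only [Finsupp.add_apply, Finsupp.smul_apply, sqfreeExp_apply, smul_eq_mul,
    Finsupp.mapRange_apply, Finset.mem_filter, Finset.mem_univ, true_and]
  split_ifs <;> omega

lemma frobeniusSum_surjective : Function.Surjective (frobeniusSum K V) := by
  intro p
  induction p using MvPolynomial.induction_on' with
  | monomial m c =>
    obtain ⟨σ, b, rfl⟩ := exists_eq_sqfreeExp_add m
    refine ⟨Pi.single σ (monomial b c), ?_⟩
    rw [frobeniusSum_apply, Finset.sum_eq_single σ]
    · simp [expand_monomial, monomial_mul]
    · intro τ _ hτ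
      simp [hτ]
    · simp
  | add p q hp hq =>
    obtain ⟨g, rfl⟩ := hp
    obtain ⟨h, rfl⟩ := hq
    exact ⟨g + h, map_add _ _ _⟩

lemma frobeniusSum_smul (a : MvPolynomial V K) (g : Finset V → MvPolynomial V K) :
    frobeniusSum K V (a • g) = expand 2 a * frobeniusSum K V g := by
  rw [frobeniusSum_apply, frobeniusSum_apply, Finset.mul_sum]
  refine Finset.sum_congr rfl fun σ _ ↦ ?_
  rw [Pi.smul_apply, smul_eq_mul, map_mul]
  ring

lemma frobeniusSum_mem_iff (g : Finset V → MvPolynomial V K) :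
    frobeniusSum K V g ∈ monIdeal K L ↔ ∀ σ, g σ ∈ monIdeal K (frobeniusPart L σ) := by
  simp only [mem_monIdeal, mem_frobeniusPart]
  constructor
  · intro h σ b hb
    exact h _ (by rwa [coeff_frobeniusSum])
  · intro h m hm
    obtain ⟨σ, b, rfl⟩ := exists_eq_sqfreeExp_add m
    exact h σ b (by rwa [coeff_frobeniusSum] at hm)

/-- The depth of a monomial quotient is the minimum of the depths of its Frobenius parts. -/
theorem monGrade_iff_frobeniusPart :
    MonGrade K L d ↔ ∀ σ, MonGrade K (frobeniusPart L σ) d := by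
  unfold MonGrade
  rw [← gradeGE_pi_iff]
  symm
  refine gradeGE_iff_of_surjective (expand 2 : MvPolynomial V K →ₐ[K] MvPolynomial V K).toRingHom
    (LinearMap.pi fun σ ↦ (Submodule.mkQ (monIdeal K (frobeniusPart L σ))).comp (LinearMap.proj σ))
    ((Submodule.mkQ (monIdeal K L)).toAddMonoidHom.comp (frobeniusSum K V))
    (fun y ↦ ?_) ((Submodule.mkQ_surjective _).comp frobeniusSum_surjective) (fun g ↦ ?_)
    (fun a g ↦ congrArg (Submodule.mkQ (monIdeal K L)) (frobeniusSum_smul a g))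
    map_expand_maxIdeal_le maxIdeal_le_radical_map_expand
  · choose g hg using fun σ ↦ Submodule.mkQ_surjective _ (y σ)
    exact ⟨g, funext hg⟩
  · rw [funext_iff]
    refine (forall_congr' fun σ ↦ ?_).trans ((frobeniusSum_mem_iff g).symm.trans
      (Submodule.Quotient.mk_eq_zero _).symm)
    exact Submodule.Quotient.mk_eq_zero _

end Frobenius

end MonomialIdeals

noncomputable section Complexes

variable {K : Type} [Field K] {V : Type}

/-- The exponents of the monomials supported on faces of `Γ`. -/
def faceExp (Γ : LowerSet (Finset V)) : LowerSet (V →₀ ℕ) where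
  carrier := {m | m.support ∈ Γ}
  lower' := fun _ _ hba ha ↦ Γ.lower (Finsupp.support_mono hba) ha

lemma mem_faceExp {Γ : LowerSet (Finset V)} {m : V →₀ ℕ} : m ∈ faceExp Γ ↔ m.support ∈ Γ := Iff.rfl

lemma faceExp_sup (Γ Γ' : LowerSet (Finset V)) : faceExp (Γ ⊔ Γ') = faceExp Γ ⊔ faceExp Γ' := by
  ext m
  simp [mem_faceExp]

lemma faceExp_inf (Γ Γ' : LowerSet (Finset V)) : faceExp (Γ ⊓ Γ') = faceExp Γ ⊓ faceExp Γ' := by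
  ext m
  simp [mem_faceExp]

lemma faceExp_bot : faceExp (⊥ : LowerSet (Finset V)) = ⊥ := by
  ext m
  simp [mem_faceExp]

variable (K) in
/-- The Stanley–Reisner ring of `Γ` over `K` has depth at least `d`. -/
def FaceGrade (Γ : LowerSet (Finset V)) (d : ℕ) : Prop := MonGrade K (faceExp Γ) d

variable {Γ Γ' : LowerSet (Finset V)} {d : ℕ}

lemma FaceGrade.mono {e : ℕ} (h : FaceGrade K Γ d) (hde : e ≤ d) : FaceGrade K Γ e :=
  MonGrade.mono h hde

lemma faceGrade_bot : FaceGrade K (⊥ : LowerSet (Finset V)) d := by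
  rw [FaceGrade, faceExp_bot]
  exact monGrade_bot

lemma FaceGrade.sup (h : FaceGrade K Γ d) (h' : FaceGrade K Γ' d)
    (h'' : FaceGrade K (Γ ⊓ Γ') (d - 1)) : FaceGrade K (Γ ⊔ Γ') d := by
  cases d with
  | zero => exact monGrade_zero
  | succ d =>
    rw [FaceGrade, faceExp_inf] at h''
    rw [FaceGrade, faceExp_sup]
    exact MonGrade.sup h h' h''

lemma FaceGrade.inf (h : FaceGrade K Γ d) (h' : FaceGrade K Γ' d)
    (h'' : FaceGrade K (Γ ⊔ Γ') d) : FaceGrade K (Γ ⊓ Γ') (d - 1) := by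
  cases d with
  | zero => exact monGrade_zero
  | succ d =>
    rw [FaceGrade, faceExp_sup] at h''
    rw [FaceGrade, faceExp_inf]
    exact MonGrade.inf (h.mono (Nat.le_succ d)) (h'.mono (Nat.le_succ d)) h''

lemma span_X_eq_monIdeal (v : V) : Ideal.span {(X v : MvPolynomial V K)} =
    monIdeal K ⟨{m | m v = 0}, fun a b hba (ha : a v = 0) ↦ by
      have := hba v
      change b v = 0
      omega⟩ := by
  ext p
  have := mem_ideal_span_X_image (x := p) (s := {v})
  rw [Set.image_singleton] at this
  rw [this, mem_monIdeal]
  refine forall_congr' fun m ↦ ?_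
  rw [mem_support_iff]
  simp only [Set.mem_singleton_iff, exists_eq_left]
  rfl

lemma X_mem_maxIdeal (v : V) : X v ∈ maxIdeal K V := Ideal.subset_span (Set.mem_range_self v)


/-- The star of `σ`. -/
def starComplex [DecidableEq V] (Γ : LowerSet (Finset V)) (σ : Finset V) : LowerSet (Finset V) where
  carrier := {H | H ∪ σ ∈ Γ}
  lower' := fun _ _ hba ha ↦ Γ.lower (Finset.union_subset_union_left hba) ha

/-- The faces that are disjoint from `A`. -/
def deleteComplex (Γ : LowerSet (Finset V)) (A : Finset V) : LowerSet (Finset V) where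
  carrier := {H | H ∈ Γ ∧ Disjoint H A}
  lower' := fun _ _ hba ha ↦ ⟨Γ.lower hba ha.1, ha.2.mono_left hba⟩

lemma mem_starComplex [DecidableEq V] {σ H : Finset V} : H ∈ starComplex Γ σ ↔ H ∪ σ ∈ Γ := Iff.rfl

lemma mem_deleteComplex {A H : Finset V} : H ∈ deleteComplex Γ A ↔ H ∈ Γ ∧ Disjoint H A := Iff.rfl

lemma deleteComplex_empty (Γ : LowerSet (Finset V)) : deleteComplex Γ ∅ = Γ := by
  refine SetLike.ext fun H ↦ ?_
  simp [mem_deleteComplex]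

lemma starComplex_empty [DecidableEq V] (Γ : LowerSet (Finset V)) : starComplex Γ ∅ = Γ := by
  refine SetLike.ext fun H ↦ ?_
  simp [mem_starComplex]

lemma support_sqfreeExp_add [DecidableEq V] (σ : Finset V) (b : V →₀ ℕ) :
    (sqfreeExp σ + 2 • b).support = b.support ∪ σ := by
  ext i
  simp only [Finsupp.mem_support_iff, Finsupp.add_apply, Finsupp.smul_apply, sqfreeExp_apply,
    smul_eq_mul, Finset.mem_union]
  split_ifs with h <;> simp [h]

lemma frobeniusPart_faceExp [DecidableEq V] (Γ : LowerSet (Finset V)) (σ : Finset V) :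
    frobeniusPart (faceExp Γ) σ = faceExp (starComplex Γ σ) := by
  ext b
  change (sqfreeExp σ + 2 • b).support ∈ Γ ↔ b.support ∪ σ ∈ Γ
  rw [support_sqfreeExp_add]

lemma FaceGrade.star [DecidableEq V] [Fintype V] (h : FaceGrade K Γ d) (σ : Finset V) :
    FaceGrade K (starComplex Γ σ) d := by
  rw [FaceGrade, ← frobeniusPart_faceExp]
  exact monGrade_iff_frobeniusPart.1 h σ

/-- Removing a cone vertex lowers the depth by one. -/
lemma faceGrade_succ_iff_delete [DecidableEq V] [Finite V] {v : V} (hv : ∀ H ∈ Γ, insert v H ∈ Γ) :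
    FaceGrade K Γ (d + 1) ↔ FaceGrade K (deleteComplex Γ {v}) d := by
  unfold FaceGrade MonGrade
  rw [gradeGE_succ_iff_sup_span_singleton (X_mem_maxIdeal v), span_X_eq_monIdeal, ← monIdeal_inf]
  · have : faceExp Γ ⊓ ⟨{m | m v = 0}, fun a b hba (ha : a v = 0) ↦ by
        have := hba v
        change b v = 0
        omega⟩ = faceExp (deleteComplex Γ {v}) := by
      refine SetLike.ext fun m ↦ ?_
      simp only [LowerSet.mem_inf_iff, mem_faceExp, mem_deleteComplex,
        Finset.disjoint_singleton_right, Finsupp.mem_support_iff, not_not]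
      rfl
    rw [this]
  · intro p hp
    rw [mem_monIdeal] at hp ⊢
    intro m hm hmΓ
    refine hp (Finsupp.single v 1 + m) (by rwa [coeff_X_mul]) (Γ.lower ?_ (hv _ hmΓ))
    intro i hi
    by_cases h : i = v
    · simp [h]
    · simpa [Finsupp.single_apply, Ne.symm h, h] using hi

lemma faceExp_Iic_empty : monIdeal K (faceExp (LowerSet.Iic (∅ : Finset V))) = maxIdeal K V := by
  ext p
  rw [maxIdeal, ← Set.image_univ, mem_ideal_span_X_image, mem_monIdeal]
  refine forall_congr' fun m ↦ ?_
  rw [mem_support_iff]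
  refine imp_congr_right fun _ ↦ ?_
  rw [mem_faceExp, LowerSet.mem_Iic_iff, Finset.subset_empty,
    Finsupp.support_eq_empty, Finsupp.ext_iff]
  simp

lemma maxIdeal_ne_top : maxIdeal K V ≠ ⊤ := by
  rw [← faceExp_Iic_empty, Ne, Ideal.eq_top_iff_one, mem_monIdeal]
  intro h
  exact h 0 (by simp) (by simp [mem_faceExp])

lemma faceGrade_Iic_iff [DecidableEq V] [Finite V] (T : Finset V) :
    FaceGrade K (LowerSet.Iic T) d ↔ d ≤ T.card := by
  induction T using Finset.induction_on generalizing d with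
  | empty =>
    constructor
    · intro h
      by_contra! hd
      obtain ⟨x, hx, hreg⟩ := (GradeGE.mono h hd : GradeGE _ _ (0 + 1)).exists_isSMulRegular
      rw [faceExp_Iic_empty] at hreg
      have h1 : (Submodule.mkQ (maxIdeal K V)) 1 = 0 := by
        refine (isSMulRegular_iff_right_eq_zero_of_smul.1 hreg) _ ?_
        rw [← map_smul]
        exact (Submodule.Quotient.mk_eq_zero _).2 (by simpa using hx)
      exact maxIdeal_ne_top ((Ideal.eq_top_iff_one _).2 ((Submodule.Quotient.mk_eq_zero _).1 h1))
    · intro h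
      obtain rfl : d = 0 := by simpa using h
      exact monGrade_zero
  | insert v T hv ih =>
    cases d with
    | zero => exact iff_of_true monGrade_zero (Nat.zero_le _)
    | succ d =>
      have : deleteComplex (LowerSet.Iic (insert v T)) {v} = LowerSet.Iic T := by
        refine SetLike.ext fun H ↦ ?_
        simp only [mem_deleteComplex, LowerSet.mem_Iic_iff,
          Finset.disjoint_singleton_right]
        refine ⟨fun h ↦ (Finset.subset_insert_iff_of_notMem h.2).1 h.1,
          fun h ↦ ⟨h.trans (Finset.subset_insert v T), fun hH ↦ hv (h hH)⟩⟩
      rw [faceGrade_succ_iff_delete (v := v), this, ih, Finset.card_insert_of_notMem hv,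
        Nat.add_le_add_iff_right]
      intro H hH
      exact Finset.insert_subset (Finset.mem_insert_self _ _) hH

/-- The depth is at most the size of any facet. -/
lemma FaceGrade.le_card_of_maximal [DecidableEq V] [Fintype V] (h : FaceGrade K Γ d) {T : Finset V} (hT : T ∈ Γ)
    (hmax : ∀ H ∈ Γ, T ⊆ H → H ⊆ T) : d ≤ T.card := by
  have : starComplex Γ T = LowerSet.Iic T := by
    refine SetLike.ext fun H ↦ ?_
    rw [mem_starComplex, LowerSet.mem_Iic_iff]
    refine ⟨fun hH ↦ Finset.subset_union_left.trans (hmax _ hH Finset.subset_union_right),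
      fun hH ↦ ?_⟩
    rwa [Finset.union_eq_right.2 hH]
  rw [← faceGrade_Iic_iff (K := K), ← this]
  exact h.star T

lemma exists_maximal_face [Fintype V] {H : Finset V} (hH : H ∈ Γ) :
    ∃ T ∈ Γ, H ⊆ T ∧ ∀ H' ∈ Γ, T ⊆ H' → H' ⊆ T := by
  obtain ⟨T, hHT, hT⟩ := (Set.toFinite (Γ : Set (Finset V))).exists_le_maximal hH
  exact ⟨T, hT.1, hHT, fun H' hH' h ↦ hT.2 hH' h⟩

end Complexes

noncomputable section IndependenceComplex

variable {V : Type} (G : SimpleGraph V)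

/-- The independence complex, bundled as a lower set. -/
def indepFaces : LowerSet (Finset V) where
  carrier := indepComplex G
  lower' := fun _ _ hba ha i hi j hj ↦ ha i (hba hi) j (hba hj)

variable {G}

lemma mem_indepFaces {H : Finset V} : H ∈ indepFaces G ↔ ∀ i ∈ H, ∀ j ∈ H, ¬ G.Adj i j := Iff.rfl

lemma empty_mem_indepFaces : ∅ ∈ indepFaces G := by simp [mem_indepFaces]

section Number

variable [Fintype V]

lemma bddAbove_card_indep : BddAbove {c | ∃ F ∈ indepComplex G, F.card = c} :=
  ⟨Fintype.card V, by rintro _ ⟨F, -, rfl⟩; exact F.card_le_univ⟩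

lemma card_le_indepNumber {F : Finset V} (hF : F ∈ indepFaces G) : F.card ≤ indepNumber G :=
  le_csSup bddAbove_card_indep ⟨F, hF, rfl⟩

variable (G) in
lemma exists_card_eq_indepNumber : ∃ F ∈ indepFaces G, F.card = indepNumber G :=
  Nat.sSup_mem (s := {c | ∃ F ∈ indepComplex G, F.card = c}) ⟨0, ∅, empty_mem_indepFaces, rfl⟩
    bddAbove_card_indep

end Number

section Square

variable [DecidableEq V]

variable (G) in
/-- The exponents of the monomials outside the square of the edge ideal. -/
def squareExp : LowerSet (V →₀ ℕ) where
  carrier := {m | ∀ i j k l, G.Adj i j → G.Adj k l →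
    ¬ (Finsupp.single i 1 + Finsupp.single j 1 + (Finsupp.single k 1 + Finsupp.single l 1) ≤ m)}
  lower' := fun _ _ hba ha i j k l hij hkl h ↦ ha i j k l hij hkl (h.trans hba)

variable (G) in
/-- The complex of sets `B` such that any two edges inside `σ ∪ B` share a vertex outside `B`. -/
def squareComplex (σ : Finset V) : LowerSet (Finset V) where
  carrier := {B | ∀ i j k l, G.Adj i j → G.Adj k l → i ∈ B ∪ σ → j ∈ B ∪ σ → k ∈ B ∪ σ →
    l ∈ B ∪ σ → i = k ∧ i ∉ B ∨ i = l ∧ i ∉ B ∨ j = k ∧ j ∉ B ∨ j = l ∧ j ∉ B}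
  lower' := by
    intro B B' hB h i j k l hij hkl hi hj hk hl
    have hs := Finset.union_subset_union_left (t := σ) hB
    have := h i j k l hij hkl (hs hi) (hs hj) (hs hk) (hs hl)
    have hB : ∀ i, i ∉ B → i ∉ B' := fun i hi hi' ↦ hi (hB hi')
    grind

lemma mem_squareComplex {σ B : Finset V} : B ∈ squareComplex G σ ↔
    ∀ i j k l, G.Adj i j → G.Adj k l → i ∈ B ∪ σ → j ∈ B ∪ σ → k ∈ B ∪ σ →
    l ∈ B ∪ σ → i = k ∧ i ∉ B ∨ i = l ∧ i ∉ B ∨ j = k ∧ j ∉ B ∨ j = l ∧ j ∉ B := Iff.rfl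

lemma frobeniusPart_squareExp (σ : Finset V) :
    frobeniusPart (squareExp G) σ = faceExp (squareComplex G σ) := by
  refine SetLike.ext fun b ↦ ?_
  rw [mem_faceExp, mem_squareComplex]
  change (∀ i j k l, G.Adj i j → G.Adj k l → ¬ _) ↔ _
  refine forall_congr' fun i ↦ forall_congr' fun j ↦ forall_congr' fun k ↦ forall_congr' fun l ↦
    imp_congr_right fun hij ↦ imp_congr_right fun hkl ↦ ?_
  have hij := hij.ne
  have hkl := hkl.ne
  rw [Finsupp.le_def]
  simp only [Finsupp.add_apply, Finsupp.smul_apply, sqfreeExp_apply, smul_eq_mul,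
    Finsupp.single_apply, Finset.mem_union, Finsupp.mem_support_iff]
  constructor
  · intro h
    push Not at h
    obtain ⟨v, hv⟩ := h
    grind
  · intro h h1
    have h2 := h1 i
    have h3 := h1 j
    have h4 := h1 k
    have h5 := h1 l
    grind

lemma squareComplex_empty : squareComplex G ∅ = indepFaces G := by
  refine SetLike.ext fun B ↦ ?_
  rw [mem_squareComplex, mem_indepFaces]
  simp only [Finset.union_empty]
  constructor
  · intro h i hi j hj hij
    have := h i j i j hij hij hi hj hi hj
    tauto
  · intro h i j k l hij _ hi hj
    exact absurd hij (h i hi j hj)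

/-- Triangle-freeness, stated elementwise. -/
lemma cliqueFree_three_iff : G.CliqueFree 3 ↔ ∀ a b c, G.Adj a b → G.Adj b c → ¬ G.Adj a c := by
  constructor
  · intro h a b c hab hbc hac
    exact h {a, b, c} (SimpleGraph.is3Clique_triple_iff.2 ⟨hab, hac, hbc⟩)
  · intro h s hs
    obtain ⟨a, b, c, hab, hac, hbc, -⟩ := SimpleGraph.is3Clique_iff.1 hs
    exact h a b c hab hbc hac

lemma mem_squareComplex_iff (hG : G.CliqueFree 3) {σ B : Finset V} :
    B ∈ squareComplex G σ ↔ B ∪ σ ∈ indepFaces G ∨ ∃ c ∈ σ, B ∪ σ.erase c ∈ indepFaces G := by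
  rw [cliqueFree_three_iff] at hG
  constructor
  · intro h
    rw [or_iff_not_imp_left]
    intro h1
    rw [mem_squareComplex] at h
    obtain ⟨i, hi, j, hj, hij⟩ : ∃ i ∈ B ∪ σ, ∃ j ∈ B ∪ σ, G.Adj i j := by
      simpa [mem_indepFaces] using h1
    have key : ∀ c ∈ B ∪ σ, c ∉ B → (∀ k ∈ B ∪ σ, ∀ l ∈ B ∪ σ, G.Adj k l → c = k ∨ c = l) →
        ∃ c ∈ σ, B ∪ σ.erase c ∈ indepFaces G := by
      intro c hc hcB hall
      refine ⟨c, (Finset.mem_union.1 hc).resolve_left hcB, fun k hk l hl hkl ↦ ?_⟩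
      have hsub : B ∪ σ.erase c ⊆ B ∪ σ := Finset.union_subset_union_right (Finset.erase_subset _ _)
      have := hall k (hsub hk) l (hsub hl) hkl
      grind
    have hne := hij.ne
    by_contra hcon
    have keyi : i ∉ B → ∃ k ∈ B ∪ σ, ∃ l ∈ B ∪ σ, G.Adj k l ∧ i ≠ k ∧ i ≠ l := by
      intro hiB
      by_contra! hc
      exact hcon (key i hi hiB fun k hk l hl hkl ↦ by have := hc k hk l hl hkl; tauto)
    have keyj : j ∉ B → ∃ k ∈ B ∪ σ, ∃ l ∈ B ∪ σ, G.Adj k l ∧ j ≠ k ∧ j ≠ l := by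
      intro hiB
      by_contra! hc
      exact hcon (key j hj hiB fun k hk l hl hkl ↦ by have := hc k hk l hl hkl; tauto)
    have hiB : i ∉ B := by
      intro hiB
      have hjB : j ∉ B := by
        have := h i j i j hij hij hi hj hi hj
        tauto
      obtain ⟨k, hk, l, hl, hkl, h1, h2⟩ := keyj hjB
      have := h i j k l hij hkl hi hj hk hl
      tauto
    have hjB : j ∉ B := by
      intro hjB
      obtain ⟨k, hk, l, hl, hkl, h1, h2⟩ := keyi hiB
      have := h i j k l hij hkl hi hj hk hl
      tauto
    obtain ⟨k, hk, l, hl, hkl, h1, h2⟩ := keyi hiB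
    obtain ⟨k', hk', l', hl', hkl', h1', h2'⟩ := keyj hjB
    have e1 := h i j k l hij hkl hi hj hk hl
    have e2 := h i j k' l' hij hkl' hi hj hk' hl'
    have e3 := h k l k' l' hkl hkl' hk hl hk' hl'
    have s1 := hkl.symm
    have s2 := hkl'.symm
    have s3 := hij.symm
    have t1 := hG i j
    grind
  · intro h
    rw [mem_squareComplex]
    intro i j k l hij hkl hi hj hk hl
    rcases h with h | ⟨c, hc, h⟩
    · exact absurd hij (h i hi j hj)
    · rw [mem_indepFaces] at h
      have e1 := h i
      have e2 := h k
      have h1 := e1 |> fun f hi ↦ f hi j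
      have h2 := e2 |> fun f hi ↦ f hi l
      grind

end Square

end IndependenceComplex

noncomputable section DepthOfSquare

variable {K : Type} [Field K] {V : Type} {G : SimpleGraph V}

variable (G) in
/-- The independent sets of `G` that avoid all neighbours of `p` and of `q`. -/
def edgeFaces (p q : V) : LowerSet (Finset V) where
  carrier := {H | H ∈ indepFaces G ∧ ∀ v ∈ H, ¬ G.Adj p v ∧ ¬ G.Adj q v}
  lower' := fun _ _ hba ha ↦ ⟨(indepFaces G).lower hba ha.1, fun v hv ↦ ha.2 v (hba hv)⟩

lemma mem_edgeFaces {p q : V} {H : Finset V} :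
    H ∈ edgeFaces G p q ↔ H ∈ indepFaces G ∧ ∀ v ∈ H, ¬ G.Adj p v ∧ ¬ G.Adj q v := Iff.rfl

variable [DecidableEq V]

lemma union_mem_indepFaces {A B : Finset V} : A ∪ B ∈ indepFaces G ↔
    A ∈ indepFaces G ∧ B ∈ indepFaces G ∧ ∀ a ∈ A, ∀ b ∈ B, ¬ G.Adj a b := by
  simp only [mem_indepFaces, Finset.mem_union]
  have := G.symm
  constructor
  · intro h
    exact ⟨fun i hi j hj ↦ h i (.inl hi) j (.inl hj), fun i hi j hj ↦ h i (.inr hi) j (.inr hj),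
      fun i hi j hj ↦ h i (.inl hi) j (.inr hj)⟩
  · rintro ⟨h1, h2, h3⟩ i (hi | hi) j (hj | hj)
    · exact h1 i hi j hj
    · exact h3 i hi j hj
    · exact fun h ↦ h3 j hj i hi h.symm
    · exact h2 i hi j hj

lemma insert_mem_indepFaces {x : V} {B : Finset V} : insert x B ∈ indepFaces G ↔
    B ∈ indepFaces G ∧ ∀ b ∈ B, ¬ G.Adj x b := by
  rw [Finset.insert_eq, union_mem_indepFaces]
  simp [mem_indepFaces]

variable (G) in
/-- The union of the stars of the sets `σ \ {c}`, `c ∈ C`. -/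
def starErase (σ C : Finset V) : LowerSet (Finset V) where
  carrier := {B | ∃ c ∈ C, B ∪ σ.erase c ∈ indepFaces G}
  lower' := by
    rintro _ _ hba ⟨c, hc, h⟩
    exact ⟨c, hc, (indepFaces G).lower (Finset.union_subset_union_left hba) h⟩

lemma mem_starErase {σ C B : Finset V} :
    B ∈ starErase G σ C ↔ ∃ c ∈ C, B ∪ σ.erase c ∈ indepFaces G := Iff.rfl

lemma starErase_empty (σ : Finset V) : starErase G σ ∅ = ⊥ := by
  refine SetLike.ext fun B ↦ ?_
  simp [mem_starErase]

lemma starErase_insert (σ C : Finset V) (c : V) :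
    starErase G σ (insert c C) = starErase G σ C ⊔ starComplex (indepFaces G) (σ.erase c) := by
  refine SetLike.ext fun B ↦ ?_
  rw [LowerSet.mem_sup_iff, mem_starErase, mem_starErase, mem_starComplex]
  simp only [Finset.mem_insert, exists_eq_or_imp]
  exact or_comm

lemma starErase_pair_eq {σ : Finset V} {p q : V} (hp : p ∈ σ) (hq : q ∈ σ) (hpq : G.Adj p q) :
    starErase G σ σ = starErase G σ {p, q} := by
  refine SetLike.ext fun B ↦ ?_
  rw [mem_starErase, mem_starErase]
  constructor
  · rintro ⟨c, hc, h⟩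
    refine ⟨c, ?_, h⟩
    rw [union_mem_indepFaces] at h
    by_contra hcpq
    simp only [Finset.mem_insert, Finset.mem_singleton, not_or] at hcpq
    exact h.2.1 p (Finset.mem_erase.2 ⟨Ne.symm hcpq.1, hp⟩) q
      (Finset.mem_erase.2 ⟨Ne.symm hcpq.2, hq⟩) hpq
  · rintro ⟨c, hc, h⟩
    exact ⟨c, by grind, h⟩

lemma starComplex_erase_inf_starComplex_erase {σ : Finset V} {p q : V} (hp : p ∈ σ) (hq : q ∈ σ)
    (hpq : G.Adj p q) :
    starComplex (indepFaces G) (σ.erase p) ⊓ starComplex (indepFaces G) (σ.erase q) =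
      starComplex (edgeFaces G p q) ((σ.erase p).erase q) := by
  refine SetLike.ext fun B ↦ ?_
  rw [LowerSet.mem_inf_iff, mem_starComplex, mem_starComplex, mem_starComplex, mem_edgeFaces]
  have hne := hpq.ne
  have e1 : σ.erase p = insert q ((σ.erase p).erase q) := by grind
  have e2 : σ.erase q = insert p ((σ.erase p).erase q) := by grind
  constructor
  · rintro ⟨h1, h2⟩
    rw [e1, Finset.union_insert, insert_mem_indepFaces] at h1
    rw [e2, Finset.union_insert, insert_mem_indepFaces] at h2
    exact ⟨h1.1, fun v hv ↦ ⟨h2.2 v hv, h1.2 v hv⟩⟩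
  · rintro ⟨h1, h2⟩
    rw [e2, e1, Finset.union_insert, Finset.union_insert, insert_mem_indepFaces,
      insert_mem_indepFaces]
    grind

variable (G) in
/-- Every vertex outside an independent set `F` that is not adjacent to `F` can be replaced by one
of its neighbours. -/
def NeighborExchange : Prop := ∀ x F, F ∈ indepFaces G → x ∉ F → insert x F ∈ indepFaces G →
  ∃ y, G.Adj x y ∧ insert y F ∈ indepFaces G

variable (G) in
/-- The sets `H` avoiding `A` such that `H ∪ F ∪ {y}` is independent for some `y ∈ Y`. -/
def starInsert (F A Y : Finset V) : LowerSet (Finset V) where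
  carrier := {H | Disjoint H A ∧ ∃ y ∈ Y, H ∪ insert y F ∈ indepFaces G}
  lower' := by
    rintro _ _ hba ⟨hA, c, hc, h⟩
    exact ⟨hA.mono_left hba, c, hc, (indepFaces G).lower (Finset.union_subset_union_left hba) h⟩

lemma mem_starInsert {F A Y H : Finset V} : H ∈ starInsert G F A Y ↔
    Disjoint H A ∧ ∃ y ∈ Y, H ∪ insert y F ∈ indepFaces G := Iff.rfl

variable [Fintype V] {d : ℕ}

lemma faceGrade_starErase_of_mem (h : FaceGrade K (indepFaces G) d) {σ : Finset V}
    (hσ : σ ∈ indepFaces G) (C : Finset V) : FaceGrade K (starErase G σ C) d := by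
  induction C using Finset.induction_on with
  | empty =>
    rw [starErase_empty]
    exact faceGrade_bot
  | insert c C hc ih =>
    rw [starErase_insert]
    refine FaceGrade.sup ih (h.star _) ?_
    rcases C.eq_empty_or_nonempty with rfl | ⟨c', hc'⟩
    · rw [starErase_empty, bot_inf_eq]
      exact faceGrade_bot
    · have : starErase G σ C ⊓ starComplex (indepFaces G) (σ.erase c) =
          starComplex (indepFaces G) σ := by
        refine SetLike.ext fun B ↦ ?_
        rw [LowerSet.mem_inf_iff, mem_starErase, mem_starComplex, mem_starComplex]
        constructor
        · rintro ⟨⟨c', hc', h1⟩, h2⟩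
          rw [union_mem_indepFaces] at h1 h2 ⊢
          refine ⟨h1.1, hσ, fun a ha b hb ↦ ?_⟩
          by_cases hbc : b = c
          · exact h1.2.2 a ha b (Finset.mem_erase.2 ⟨by grind, hb⟩)
          · exact h2.2.2 a ha b (Finset.mem_erase.2 ⟨hbc, hb⟩)
        · intro h1
          have h2 : ∀ c, B ∪ σ.erase c ∈ indepFaces G := fun c ↦ (indepFaces G).lower
            (Finset.union_subset_union_right (Finset.erase_subset _ _)) h1
          exact ⟨⟨c', hc', h2 c'⟩, h2 c⟩
      rw [this]
      exact (h.star σ).mono (Nat.sub_le _ _)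

/-- Depth of the square of the edge ideal, from the depths of the independence complexes of `G` and
of its localizations at edges. -/
theorem monGrade_squareExp (hG : G.CliqueFree 3) (h : FaceGrade K (indepFaces G) d)
    (h' : ∀ p q, G.Adj p q → FaceGrade K (edgeFaces G p q) (d - 1)) :
    MonGrade K (squareExp G) d := by
  rw [monGrade_iff_frobeniusPart]
  intro σ
  rw [frobeniusPart_squareExp]
  change FaceGrade K _ d
  rcases σ.eq_empty_or_nonempty with rfl | ⟨c, hc⟩
  · rwa [squareComplex_empty]
  have : squareComplex G σ = starErase G σ σ := by
    refine SetLike.ext fun B ↦ ?_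
    rw [mem_squareComplex_iff hG, mem_starErase, or_iff_right_of_imp]
    exact fun hB ↦ ⟨c, hc, (indepFaces G).lower
      (Finset.union_subset_union_right (Finset.erase_subset _ _)) hB⟩
  rw [this]
  by_cases hσ : σ ∈ indepFaces G
  · exact faceGrade_starErase_of_mem h hσ σ
  · obtain ⟨p, hp, q, hq, hpq⟩ : ∃ p ∈ σ, ∃ q ∈ σ, G.Adj p q := by
      simpa [mem_indepFaces] using hσ
    rw [starErase_pair_eq hp hq hpq, starErase_insert, ← insert_empty_eq, starErase_insert,
      starErase_empty, bot_sup_eq]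
    refine (h.star _).sup (h.star _) ?_
    rw [starComplex_erase_inf_starComplex_erase hq hp hpq.symm]
    exact (h' q p hpq.symm).star _

lemma FaceGrade.delete_of_cone {Γ : LowerSet (Finset V)} {v : V} (hv : ∀ H ∈ Γ, insert v H ∈ Γ)
    (h : FaceGrade K Γ d) : FaceGrade K (deleteComplex Γ {v}) (d - 1) := by
  cases d with
  | zero => exact monGrade_zero
  | succ d => exact (faceGrade_succ_iff_delete hv).1 h

lemma faceGrade_starInsert {F A : Finset V}
    (ih1 : ∀ y ∉ F, insert y F ∈ indepFaces G → Disjoint A (insert y F) →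
      FaceGrade K (deleteComplex (starComplex (indepFaces G) (insert y F)) A) d)
    (ih2 : ∀ y ∉ F, insert y F ∈ indepFaces G → Disjoint A (insert y F) → ∀ Y ∈ indepFaces G,
      Disjoint Y A → Disjoint Y (insert y F) → FaceGrade K (starInsert G (insert y F) A Y) d)
    (hA : Disjoint A F) (Y : Finset V) (hY : Y ∈ indepFaces G) (hYA : Disjoint Y A)
    (hYF : Disjoint Y F) : FaceGrade K (starInsert G F A Y) d := by
  induction Y using Finset.induction_on with
  | empty =>
    have : starInsert G F A ∅ = ⊥ := by
      refine SetLike.ext fun B ↦ ?_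
      simp [mem_starInsert]
    rw [this]
    exact faceGrade_bot
  | insert y Y hyY ih =>
    rw [insert_mem_indepFaces] at hY
    rw [Finset.disjoint_insert_left] at hYA hYF
    have e : starInsert G F A (insert y Y) = starInsert G F A Y ⊔
        deleteComplex (starComplex (indepFaces G) (insert y F)) A := by
      refine SetLike.ext fun B ↦ ?_
      rw [LowerSet.mem_sup_iff, mem_deleteComplex, mem_starInsert, mem_starInsert, mem_starComplex]
      simp only [Finset.mem_insert, exists_eq_or_imp]
      rw [and_or_left, or_comm, and_comm (b := Disjoint B A)]
    rw [e]
    by_cases hyF : insert y F ∈ indepFaces G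
    · have hd : Disjoint A (insert y F) := Finset.disjoint_insert_right.2 ⟨hYA.1, hA⟩
      refine (ih hY.1 hYA.2 hYF.2).sup (ih1 y hYF.1 hyF hd) ?_
      have e' : starInsert G F A Y ⊓ deleteComplex (starComplex (indepFaces G) (insert y F)) A =
          starInsert G (insert y F) A Y := by
        refine SetLike.ext fun B ↦ ?_
        rw [LowerSet.mem_inf_iff, mem_deleteComplex, mem_starInsert, mem_starInsert,
          mem_starComplex]
        simp only [Finset.union_insert, insert_mem_indepFaces, Finset.mem_insert,
          Finset.mem_union]
        have := G.symm
        grind [SimpleGraph.adj_comm]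
      rw [e']
      exact (ih2 y hYF.1 hyF hd Y hY.1 hYA.2
        (Finset.disjoint_insert_right.2 ⟨hyY, hYF.2⟩)).mono (Nat.sub_le _ _)
    · have e' : deleteComplex (starComplex (indepFaces G) (insert y F)) A = ⊥ := by
        refine SetLike.ext fun B ↦ ?_
        rw [mem_deleteComplex, mem_starComplex]
        refine iff_of_false (fun h ↦ hyF ((indepFaces G).lower Finset.subset_union_right h.1)) ?_
        simp
      rw [e', sup_bot_eq]
      exact ih hY.1 hYA.2 hYF.2

lemma faceGrade_delete_star_of_starInsert (hG : G.CliqueFree 3)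
    (hL : NeighborExchange G)
    (hW : ∀ F ∈ indepFaces G, (∀ H ∈ indepFaces G, F ⊆ H → H ⊆ F) → d ≤ F.card) {F : Finset V}
    (hF : F ∈ indepFaces G)
    (ih : ∀ x ∉ F, insert x F ∈ indepFaces G →
      FaceGrade K (starComplex (indepFaces G) (insert x F)) d)
    (h2 : ∀ A ∈ indepFaces G, Disjoint A F → ∀ Y ∈ indepFaces G, Disjoint Y A → Disjoint Y F →
      FaceGrade K (starInsert G F A Y) d) (A : Finset V) (hA : A ∈ indepFaces G)
    (hAF : Disjoint A F) :
    FaceGrade K (deleteComplex (starComplex (indepFaces G) F) A) d := by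
  classical
  have key : ∀ A ∈ indepFaces G, Disjoint A F → ∀ a ∈ A, insert a F ∈ indepFaces G →
      FaceGrade K (deleteComplex (starComplex (indepFaces G) F) A) d := by
    intro A hA hAF a ha haF
    set Y := Finset.univ.filter fun y ↦ G.Adj a y ∧ insert y F ∈ indepFaces G with hYdef
    have hmem : ∀ y, y ∈ Y ↔ G.Adj a y ∧ insert y F ∈ indepFaces G := by simp [hYdef]
    have e : deleteComplex (starComplex (indepFaces G) F) A = starInsert G F A Y := by
      refine SetLike.ext fun H ↦ ?_
      rw [mem_deleteComplex, mem_starComplex, mem_starInsert]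
      constructor
      · rintro ⟨h, hHA⟩
        refine ⟨hHA, ?_⟩
        have haH : a ∉ H ∪ F := by
          rw [Finset.mem_union, not_or]
          exact ⟨Finset.disjoint_right.1 hHA ha, Finset.disjoint_left.1 hAF ha⟩
        by_cases h3 : insert a (H ∪ F) ∈ indepFaces G
        · obtain ⟨y, hay, hy⟩ := hL a _ h haH h3
          refine ⟨y, (hmem y).2 ⟨hay, (indepFaces G).lower ?_ hy⟩, by rwa [Finset.union_insert]⟩
          exact Finset.insert_subset_insert _ Finset.subset_union_right
        · obtain ⟨y, hy, hay⟩ : ∃ y ∈ H ∪ F, G.Adj a y := by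
            by_contra! hc
            exact h3 (insert_mem_indepFaces.2 ⟨h, hc⟩)
          have hsub : insert y F ⊆ H ∪ F := Finset.insert_subset hy Finset.subset_union_right
          refine ⟨y, (hmem y).2 ⟨hay, (indepFaces G).lower hsub h⟩, ?_⟩
          rwa [Finset.union_insert, Finset.insert_eq_of_mem hy]
      · rintro ⟨h, y, hy, hH⟩
        exact ⟨(indepFaces G).lower
          (Finset.union_subset_union_right (Finset.subset_insert _ _)) hH, h⟩
    rw [e]
    refine h2 A hA hAF Y ?_ ?_ ?_
    · intro i hi j hj hij
      exact cliqueFree_three_iff.1 hG a i j ((hmem i).1 hi).1 hij ((hmem j).1 hj).1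
    · rw [Finset.disjoint_left]
      exact fun y hy hyA ↦ hA a ha y hyA ((hmem y).1 hy).1
    · rw [Finset.disjoint_left]
      exact fun y hy hyF ↦ (insert_mem_indepFaces.1 haF).2 y hyF ((hmem y).1 hy).1
  by_cases hex : ∃ a ∈ A, insert a F ∈ indepFaces G
  · obtain ⟨a, ha, haF⟩ := hex
    exact key A hA hAF a ha haF
  · push Not at hex
    have e : deleteComplex (starComplex (indepFaces G) F) A = starComplex (indepFaces G) F := by
      refine SetLike.ext fun H ↦ ?_
      rw [mem_deleteComplex, mem_starComplex, and_iff_left_iff_imp]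
      intro h
      rw [Finset.disjoint_right]
      exact fun a ha haH ↦ hex a ha ((indepFaces G).lower
        (Finset.insert_subset (Finset.mem_union_left _ haH) Finset.subset_union_right) h)
    rw [e]
    by_cases hx : ∃ x ∉ F, insert x F ∈ indepFaces G
    · obtain ⟨x, hxF, hx⟩ := hx
      have e1 : starComplex (indepFaces G) F = deleteComplex (starComplex (indepFaces G) F) {x} ⊔
          starComplex (indepFaces G) (insert x F) := by
        refine SetLike.ext fun H ↦ ?_
        rw [LowerSet.mem_sup_iff, mem_deleteComplex, mem_starComplex, mem_starComplex,
          Finset.disjoint_singleton_right]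
        constructor
        · intro h
          by_cases hxH : x ∈ H
          · right
            rwa [Finset.union_insert, Finset.insert_eq_of_mem (Finset.mem_union_left _ hxH)]
          · exact .inl ⟨h, hxH⟩
        · rintro (h | h)
          · exact h.1
          · exact (indepFaces G).lower
              (Finset.union_subset_union_right (Finset.subset_insert _ _)) h
      have e2 : deleteComplex (starComplex (indepFaces G) F) {x} ⊓
          starComplex (indepFaces G) (insert x F) =
          deleteComplex (starComplex (indepFaces G) (insert x F)) {x} := by
        refine SetLike.ext fun H ↦ ?_
        rw [LowerSet.mem_inf_iff, mem_deleteComplex, mem_deleteComplex, mem_starComplex,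
          mem_starComplex]
        have := fun h : H ∪ insert x F ∈ indepFaces G ↦ (indepFaces G).lower
              (Finset.union_subset_union_right (Finset.subset_insert _ _)) h
        tauto
      rw [e1]
      refine FaceGrade.sup (key {x} (by simp [mem_indepFaces]) (by simpa using hxF) x (by simp) hx)
        (ih x hxF hx) ?_
      rw [e2]
      refine (ih x hxF hx).delete_of_cone fun H hH ↦ ?_
      rw [mem_starComplex] at hH ⊢
      rwa [Finset.insert_union, Finset.insert_eq_of_mem (by simp)]
    · push Not at hx
      have hmax : ∀ H ∈ indepFaces G, F ⊆ H → H ⊆ F := by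
        intro H hH hFH x hxH
        by_contra hxF
        exact hx x hxF ((indepFaces G).lower (Finset.insert_subset hxH hFH) hH)
      have e1 : starComplex (indepFaces G) F = LowerSet.Iic F := by
        refine SetLike.ext fun H ↦ ?_
        rw [mem_starComplex, LowerSet.mem_Iic_iff]
        refine ⟨fun h ↦ Finset.subset_union_left.trans (hmax _ h Finset.subset_union_right),
          fun h ↦ ?_⟩
        rwa [Finset.union_eq_right.2 h]
      rw [e1, faceGrade_Iic_iff]
      exact hW F hF hmax

variable (K) in
/-- Depth bounds for vertex deletions of stars in the independence complex, over any field. -/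
theorem faceGrade_delete_star (hG : G.CliqueFree 3)
    (hL : NeighborExchange G)
    (hW : ∀ F ∈ indepFaces G, (∀ H ∈ indepFaces G, F ⊆ H → H ⊆ F) → d ≤ F.card) (F : Finset V)
    (hF : F ∈ indepFaces G) :
    (∀ A ∈ indepFaces G, Disjoint A F →
      FaceGrade K (deleteComplex (starComplex (indepFaces G) F) A) d) ∧
    (∀ A ∈ indepFaces G, Disjoint A F → ∀ Y ∈ indepFaces G, Disjoint Y A → Disjoint Y F →
      FaceGrade K (starInsert G F A Y) d) := by
  induction hm : Fᶜ.card using Nat.strong_induction_on generalizing F with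
  | _ m ih =>
    subst hm
    have ih' : ∀ x ∉ F, insert x F ∈ indepFaces G → _ := fun x hxF hx ↦ ih _ (by
      rw [Finset.compl_insert]
      exact Finset.card_erase_lt_of_mem (Finset.mem_compl.2 hxF)) (insert x F) hx rfl
    have h2 : ∀ A ∈ indepFaces G, Disjoint A F → ∀ Y ∈ indepFaces G, Disjoint Y A →
        Disjoint Y F → FaceGrade K (starInsert G F A Y) d := fun A hA hAF ↦
      faceGrade_starInsert (fun y hy h hd ↦ (ih' y hy h).1 A hA hd)
        (fun y hy h hd ↦ (ih' y hy h).2 A hA hd) hAF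
    refine ⟨faceGrade_delete_star_of_starInsert hG hL hW hF (fun x hxF hx ↦ ?_) h2, h2⟩
    have := (ih' x hxF hx).1 ∅ empty_mem_indepFaces (Finset.disjoint_empty_left _)
    have e : deleteComplex (starComplex (indepFaces G) (insert x F)) ∅ =
        starComplex (indepFaces G) (insert x F) := by
      refine SetLike.ext fun H ↦ ?_
      simp [mem_deleteComplex]
    rwa [e] at this

end DepthOfSquare

noncomputable section NecessaryConditions

variable {K : Type} [Field K] {V : Type} {G : SimpleGraph V} [DecidableEq V] [Fintype V] {d : ℕ}

lemma MonGrade.faceGrade_squareComplex (h : MonGrade K (squareExp G) d) (σ : Finset V) :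
    FaceGrade K (squareComplex G σ) d := by
  rw [FaceGrade, ← frobeniusPart_squareExp]
  exact monGrade_iff_frobeniusPart.1 h σ

lemma MonGrade.faceGrade_indepFaces (h : MonGrade K (squareExp G) d) :
    FaceGrade K (indepFaces G) d := by
  rw [← squareComplex_empty]
  exact h.faceGrade_squareComplex ∅

lemma MonGrade.cliqueFree (h : MonGrade K (squareExp G) (indepNumber G)) : G.CliqueFree 3 := by
  rw [cliqueFree_three_iff]
  intro a b c hab hbc hac
  have h1 : ∅ ∈ squareComplex G {a, b, c} := by
    rw [mem_squareComplex]
    intro i j k l hij hkl hi hj hk hl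
    have := hij.ne
    have := hkl.ne
    grind
  obtain ⟨T, hT, -, hmax⟩ := exists_maximal_face h1
  have h2 := (h.faceGrade_squareComplex {a, b, c}).le_card_of_maximal hT hmax
  rw [mem_squareComplex] at hT
  have haT : a ∉ T := by
    intro haT
    have := hT a b a c hab hac (by simp) (by simp) (by simp) (by simp)
    have := hbc.ne
    have := hab.ne
    have := hac.ne
    grind
  have hTa : insert a T ∈ indepFaces G := by
    rw [insert_mem_indepFaces]
    constructor
    · intro i hi j hj hij
      have := hT i j i j hij hij (by simp [hi]) (by simp [hj]) (by simp [hi]) (by simp [hj])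
      tauto
    · intro x hx hax
      have := hT a x b c hax hbc (by simp) (by simp [hx]) (by simp) (by simp)
      have := hab.ne
      have := hac.ne
      tauto
  have := card_le_indepNumber hTa
  rw [Finset.card_insert_of_notMem haT] at this
  omega

lemma MonGrade.faceGrade_starComplex_edgeFaces (hG : G.CliqueFree 3)
    (h : MonGrade K (squareExp G) d) {p q : V} {F : Finset V} (hpq : G.Adj p q) (hp : p ∉ F)
    (hq : q ∉ F) : FaceGrade K (starComplex (edgeFaces G p q) F) (d - 1) := by
  have hne := hpq.ne
  set σ := insert p (insert q F) with hσ
  have hpσ : p ∈ σ := by simp [hσ]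
  have hqσ : q ∈ σ := by simp [hσ]
  have hF : F = (σ.erase p).erase q := by grind
  rw [hF, ← starComplex_erase_inf_starComplex_erase hpσ hqσ hpq]
  refine (h.faceGrade_indepFaces.star _).inf (h.faceGrade_indepFaces.star _) ?_
  have : squareComplex G σ = starErase G σ σ := by
    refine SetLike.ext fun B ↦ ?_
    rw [mem_squareComplex_iff hG, mem_starErase, or_iff_right_of_imp]
    exact fun hB ↦ ⟨p, hpσ, (indepFaces G).lower
      (Finset.union_subset_union_right (Finset.erase_subset _ _)) hB⟩
  have h1 := h.faceGrade_squareComplex σ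
  rw [this, starErase_pair_eq hpσ hqσ hpq, starErase_insert, ← insert_empty_eq, starErase_insert,
    starErase_empty, bot_sup_eq, sup_comm] at h1
  exact h1

lemma MonGrade.neighborExchange (hiso : noIsolated G)
    (h : MonGrade K (squareExp G) (indepNumber G)) : NeighborExchange G := by
  intro x F hF hxF hx
  have hG := h.cliqueFree
  by_contra! hc
  have hdom : F ∈ {F' | F' ⊆ F ∧ ∀ y, G.Adj x y → ∃ f ∈ F', G.Adj y f} := by
    refine ⟨subset_rfl, fun y hy ↦ ?_⟩
    by_contra! hy'
    exact hc y hy (insert_mem_indepFaces.2 ⟨hF, hy'⟩)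
  obtain ⟨F₀, -, ⟨hF₀F, hF₀⟩, hmin⟩ := (Set.toFinite _).exists_le_minimal hdom
  have hF₀i := (indepFaces G).lower hF₀F hF
  rw [insert_mem_indepFaces] at hx
  obtain ⟨w, hw⟩ := hiso x
  obtain ⟨f, hf, -⟩ := hF₀ w hw
  obtain ⟨y, hxy, hy⟩ : ∃ y, G.Adj x y ∧ ∀ g ∈ F₀.erase f, ¬ G.Adj y g := by
    by_contra! hcon
    have := hmin ⟨(Finset.erase_subset f F₀).trans hF₀F, hcon⟩ (Finset.erase_subset f F₀)
    exact Finset.notMem_erase f F₀ (this hf)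
  have hyf : G.Adj y f := by
    obtain ⟨g, hg, hyg⟩ := hF₀ y hxy
    by_cases hgf : g = f
    · rwa [← hgf]
    · exact absurd hyg (hy g (Finset.mem_erase.2 ⟨hgf, hg⟩))
  have hfx : ¬ G.Adj x f := hx.2 f (hF₀F hf)
  have hyF₀ : y ∉ F₀ := fun hyF ↦ hF₀i y hyF f hf hyf
  have hempty : ∅ ∈ starComplex (edgeFaces G y f) (F₀.erase f) := by
    rw [mem_starComplex, mem_edgeFaces, Finset.empty_union]
    exact ⟨(indepFaces G).lower (Finset.erase_subset _ _) hF₀i, fun v hv ↦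
      ⟨hy v hv, hF₀i f hf v (Finset.mem_of_mem_erase hv)⟩⟩
  obtain ⟨T, hT, -, hmax⟩ := exists_maximal_face hempty
  have hcard := (h.faceGrade_starComplex_edgeFaces hG hyf
    (fun hmem ↦ hyF₀ (Finset.mem_of_mem_erase hmem))
    (Finset.notMem_erase f F₀)).le_card_of_maximal hT hmax
  have hsub : F₀.erase f ⊆ T := Finset.subset_union_right.trans
    (hmax (T ∪ F₀.erase f) (by
      rw [mem_starComplex] at hT ⊢
      rwa [Finset.union_assoc, Finset.union_self]) Finset.subset_union_left)
  rw [mem_starComplex, Finset.union_eq_left.2 hsub, mem_edgeFaces] at hT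
  obtain ⟨hTi, hTe⟩ := hT
  have hfT : f ∉ T := fun hfT ↦ (hTe f hfT).1 hyf
  have hxT : x ∉ T := fun hxT ↦ (hTe x hxT).1 hxy.symm
  have hxf : x ≠ f := fun hxf ↦ hxF (hxf ▸ hF₀F hf)
  have hfTi : insert f T ∈ indepFaces G := insert_mem_indepFaces.2 ⟨hTi, fun t ht ↦ (hTe t ht).2⟩
  by_cases hadj : ∃ t ∈ T, G.Adj x t
  · obtain ⟨t, ht, hxt⟩ := hadj
    obtain ⟨g, hg, htg⟩ := hF₀ t hxt
    by_cases hgf : g = f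
    · exact (hTe t ht).2 (hgf ▸ htg.symm)
    · exact hTi t ht g (hsub (Finset.mem_erase.2 ⟨hgf, hg⟩)) htg
  · push Not at hadj
    have hbig : insert x (insert f T) ∈ indepFaces G := by
      rw [insert_mem_indepFaces]
      refine ⟨hfTi, fun t ht ↦ ?_⟩
      rcases Finset.mem_insert.1 ht with rfl | ht
      · exact hfx
      · exact hadj t ht
    have := card_le_indepNumber hbig
    rw [Finset.card_insert_of_notMem (by simp [hxf, hxT]), Finset.card_insert_of_notMem hfT] at this
    omega

variable (L : Type) [Field L]

/-- If the square of the edge ideal has maximal depth over one field, then the independence complex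
and those of the localizations at edges have maximal depth over every field. -/
theorem MonGrade.faceGrade_of_squareExp (hiso : noIsolated G)
    (h : MonGrade K (squareExp G) (indepNumber G)) :
    FaceGrade L (indepFaces G) (indepNumber G) ∧
      ∀ p q, G.Adj p q → FaceGrade L (edgeFaces G p q) (indepNumber G - 1) := by
  have hG := h.cliqueFree
  have key := faceGrade_delete_star L hG (h.neighborExchange hiso)
    (fun F hF hmax ↦ h.faceGrade_indepFaces.le_card_of_maximal hF hmax)
  constructor
  · have := (key ∅ empty_mem_indepFaces).1 ∅ empty_mem_indepFaces (Finset.disjoint_empty_left _)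
    rwa [deleteComplex_empty, starComplex_empty] at this
  · classical
    intro p q hpq
    set A := Finset.univ.filter fun v ↦ G.Adj q v ∧ v ≠ p with hA
    have hmem : ∀ v, v ∈ A ↔ G.Adj q v ∧ v ≠ p := by simp [hA]
    have hAi : A ∈ indepFaces G := fun i hi j hj hij ↦
      cliqueFree_three_iff.1 hG q i j ((hmem i).1 hi).1 hij ((hmem j).1 hj).1
    have h1 := (key {p} (by simp [mem_indepFaces])).1 A hAi (by simp [hmem])
    have h2 := h1.delete_of_cone (v := p) (fun H hH ↦ by
      rw [mem_deleteComplex, mem_starComplex] at hH ⊢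
      rw [Finset.insert_union, Finset.insert_eq_of_mem (by simp), Finset.disjoint_insert_left]
      exact ⟨hH.1, by simp [hmem], hH.2⟩)
    convert h2 using 1
    refine SetLike.ext fun H ↦ ?_
    rw [mem_edgeFaces, mem_deleteComplex, mem_deleteComplex, mem_starComplex, union_mem_indepFaces,
      Finset.disjoint_left, Finset.disjoint_singleton_right]
    simp only [hmem, Finset.mem_singleton, forall_eq, mem_indepFaces, G.irrefl, not_false_eq_true,
      true_and]
    have := fun v ↦ G.adj_comm p v
    have := hpq.symm
    grind

lemma card_add_one_le_of_mem_edgeFaces {p q : V} (hpq : G.Adj p q) {T : Finset V}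
    (hT : T ∈ edgeFaces G p q) : T.card + 1 ≤ indepNumber G := by
  have hp : p ∉ T := fun hp ↦ (hT.2 p hp).2 hpq.symm
  rw [← Finset.card_insert_of_notMem hp]
  exact card_le_indepNumber (insert_mem_indepFaces.2 ⟨hT.1, fun v hv ↦ (hT.2 v hv).1⟩)

lemma exists_card_add_one_eq_of_faceGrade {p q : V} (hpq : G.Adj p q)
    (h : FaceGrade K (edgeFaces G p q) (indepNumber G - 1)) :
    ∃ T ∈ edgeFaces G p q, T.card + 1 = indepNumber G := by
  have h0 : ∅ ∈ edgeFaces G p q := ⟨empty_mem_indepFaces, by simp⟩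
  obtain ⟨T, hT, -, hmax⟩ := exists_maximal_face h0
  have := h.le_card_of_maximal hT hmax
  have := card_add_one_le_of_mem_edgeFaces hpq hT
  exact ⟨T, hT, by omega⟩

end NecessaryConditions

noncomputable section EdgeIdeals

variable {K : Type} [Field K] {V : Type} {G : SimpleGraph V}

lemma sqfreeExp_le_iff [DecidableEq V] {F : Finset V} {m : V →₀ ℕ} :
    sqfreeExp F ≤ m ↔ F ⊆ m.support := by
  simp only [Finsupp.le_def, sqfreeExp_apply, Finset.subset_iff, Finsupp.mem_support_iff]
  refine forall_congr' fun i ↦ ?_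
  split_ifs with h <;> simp [h, Nat.one_le_iff_ne_zero]

lemma prod_X_eq_monomial (F : Finset V) :
    ∏ i ∈ F, (X i : MvPolynomial V K) = monomial (sqfreeExp F) 1 := by
  classical
  rw [monomial_eq, C_1, one_mul, Finsupp.prod_of_support_subset (s := F)]
  · refine Finset.prod_congr rfl fun i hi ↦ ?_
    simp [sqfreeExp_apply, hi]
  · intro i hi
    by_contra h
    simp [sqfreeExp_apply, h] at hi
  · simp

lemma srIdeal_eq_monIdeal (Γ : LowerSet (Finset V)) :
    srIdeal K (Γ : Set (Finset V)) = monIdeal K (faceExp Γ) := by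
  classical
  have : {m : MvPolynomial V K | ∃ F : Finset V, F ∉ (Γ : Set (Finset V)) ∧ m = ∏ i ∈ F, X i} =
      (fun s ↦ monomial s (1 : K)) '' (sqfreeExp '' {F | F ∉ Γ}) := by
    ext p
    simp only [prod_X_eq_monomial]
    constructor
    · rintro ⟨F, hF, rfl⟩
      exact ⟨_, ⟨F, hF, rfl⟩, rfl⟩
    · rintro ⟨_, ⟨F, hF, rfl⟩, rfl⟩
      exact ⟨F, hF, rfl⟩
  rw [srIdeal, this]
  ext p
  rw [mem_ideal_span_monomial_image, mem_monIdeal]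
  refine forall_congr' fun m ↦ ?_
  rw [mem_support_iff]
  refine imp_congr_right fun _ ↦ ?_
  simp only [Set.exists_mem_image, sqfreeExp_le_iff, mem_faceExp]
  exact ⟨fun ⟨F, hF, hFm⟩ hm ↦ hF (Γ.lower hFm hm), fun hm ↦ ⟨_, hm, subset_rfl⟩⟩

lemma edgeIdeal_eq_span : edgeIdeal K G = Ideal.span ((fun s ↦ monomial s (1 : K)) ''
    {s | ∃ i j, G.Adj i j ∧ s = Finsupp.single i 1 + Finsupp.single j 1}) := by
  rw [edgeIdeal]
  congr 1
  ext p
  have (i j : V) : (X i * X j : MvPolynomial V K) =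
      monomial (Finsupp.single i 1 + Finsupp.single j 1) 1 := by
    simp [X, monomial_mul]
  simp only [this, Set.mem_image, Set.mem_ofPred_eq]
  constructor
  · rintro ⟨i, j, h, rfl⟩
    exact ⟨_, ⟨i, j, h, rfl⟩, rfl⟩
  · rintro ⟨_, ⟨i, j, h, rfl⟩, rfl⟩
    exact ⟨i, j, h, rfl⟩

lemma single_add_single_le_iff {i j : V} (h : i ≠ j) {m : V →₀ ℕ} :
    Finsupp.single i 1 + Finsupp.single j 1 ≤ m ↔ i ∈ m.support ∧ j ∈ m.support := by
  classical
  simp only [Finsupp.le_def, Finsupp.add_apply, Finsupp.single_apply, Finsupp.mem_support_iff]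
  constructor
  · intro hm
    have h1 := hm i
    have h2 := hm j
    grind
  · intro hm v
    grind

lemma edgeIdeal_eq_monIdeal : edgeIdeal K G = monIdeal K (faceExp (indepFaces G)) := by
  rw [edgeIdeal_eq_span]
  ext p
  rw [mem_ideal_span_monomial_image, mem_monIdeal]
  refine forall_congr' fun m ↦ ?_
  rw [mem_support_iff]
  refine imp_congr_right fun _ ↦ ?_
  rw [mem_faceExp, mem_indepFaces]
  push Not
  constructor
  · rintro ⟨_, ⟨i, j, h, rfl⟩, hm⟩
    rw [single_add_single_le_iff h.ne] at hm
    exact ⟨i, hm.1, j, hm.2, h⟩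
  · rintro ⟨i, hi, j, hj, h⟩
    exact ⟨_, ⟨i, j, h, rfl⟩, (single_add_single_le_iff h.ne).2 ⟨hi, hj⟩⟩

open Pointwise in
lemma edgeIdeal_sq_eq_monIdeal [DecidableEq V] : edgeIdeal K G ^ 2 = monIdeal K (squareExp G) := by
  rw [pow_two, edgeIdeal_eq_span, Ideal.span_mul_span']
  set E := {s | ∃ i j, G.Adj i j ∧ s = Finsupp.single i 1 + Finsupp.single j 1}
  have : (fun s ↦ monomial s (1 : K)) '' E * (fun s ↦ monomial s (1 : K)) '' E =
      (fun s ↦ monomial s (1 : K)) '' {s | ∃ e ∈ E, ∃ f ∈ E, s = e + f} := by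
    ext p
    rw [Set.mem_mul]
    constructor
    · rintro ⟨_, ⟨e, he, rfl⟩, _, ⟨f, hf, rfl⟩, rfl⟩
      exact ⟨e + f, ⟨e, he, f, hf, rfl⟩, by simp [monomial_mul]⟩
    · rintro ⟨_, ⟨e, he, f, hf, rfl⟩, rfl⟩
      exact ⟨_, ⟨e, he, rfl⟩, _, ⟨f, hf, rfl⟩, by simp [monomial_mul]⟩
  rw [this]
  ext p
  rw [mem_ideal_span_monomial_image, mem_monIdeal]
  refine forall_congr' fun m ↦ ?_
  rw [mem_support_iff]
  refine imp_congr_right fun _ ↦ ?_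
  constructor
  · rintro ⟨_, ⟨_, ⟨i, j, hij, rfl⟩, _, ⟨k, l, hkl, rfl⟩, rfl⟩, hm⟩ h
    exact h i j k l hij hkl hm
  · intro h
    by_contra! hcon
    exact h fun i j k l hij hkl ↦ hcon _ ⟨_, ⟨i, j, hij, rfl⟩, _, ⟨k, l, hkl, rfl⟩, rfl⟩

section Subtype

variable {s : Set V}

lemma support_mapDomain_val (m : s →₀ ℕ) :
    (m.mapDomain Subtype.val).support = m.support.map (Function.Embedding.subtype _) := by
  have := Finsupp.embDomain_eq_mapDomain (Function.Embedding.subtype (· ∈ s)) m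
  rw [← Finsupp.support_embDomain, this]
  rfl

lemma exists_mapDomain_val_eq {m : V →₀ ℕ} (h : ↑m.support ⊆ s) :
    ∃ m' : s →₀ ℕ, m'.mapDomain Subtype.val = m :=
  ⟨m.comapDomain Subtype.val Subtype.val_injective.injOn,
    Finsupp.mapDomain_comapDomain _ Subtype.val_injective _ (by simpa using h)⟩

lemma killCompl_surjective : Function.Surjective
    (killCompl Subtype.val_injective : MvPolynomial V K →ₐ[K] MvPolynomial s K) :=
  fun p ↦ ⟨rename Subtype.val p, killCompl_rename_app _ p⟩

variable [Finite V]

/-- The depth of a Stanley–Reisner ring does not change when adding vertices that are not faces. -/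
lemma faceGrade_subtype_iff {Γ : LowerSet (Finset V)} {Γ' : LowerSet (Finset s)}
    (hs : ∀ H ∈ Γ, ↑H ⊆ s) (h : ∀ H, H ∈ Γ' ↔ H.map (Function.Embedding.subtype _) ∈ Γ) {d : ℕ} :
    FaceGrade K Γ d ↔ FaceGrade K Γ' d := by
  unfold FaceGrade MonGrade
  have hmap : (maxIdeal K V).map (killCompl Subtype.val_injective :
      MvPolynomial V K →ₐ[K] MvPolynomial s K).toRingHom = maxIdeal K s := by
    apply le_antisymm
    · rw [maxIdeal, Ideal.map_span, Ideal.span_le]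
      rintro _ ⟨_, ⟨i, rfl⟩, rfl⟩
      change killCompl _ (X i) ∈ maxIdeal K s
      by_cases hi : i ∈ s
      · have := killCompl_rename_app (R := K) (Subtype.val_injective : Function.Injective
          (Subtype.val : s → V)) (X ⟨i, hi⟩)
        rw [rename_X] at this
        rw [this]
        exact X_mem_maxIdeal _
      · have : killCompl (Subtype.val_injective : Function.Injective (Subtype.val : s → V))
            (X i : MvPolynomial V K) = 0 := by
          simp [killCompl, hi]
        rw [this]
        exact zero_mem _
    · conv_lhs => rw [maxIdeal]
      rw [Ideal.span_le]
      rintro _ ⟨i, rfl⟩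
      have := Ideal.mem_map_of_mem (killCompl Subtype.val_injective :
        MvPolynomial V K →ₐ[K] MvPolynomial s K).toRingHom (X_mem_maxIdeal (K := K) i.1)
      have h2 := killCompl_rename_app (R := K) (Subtype.val_injective : Function.Injective
          (Subtype.val : s → V)) (X i)
      rw [rename_X] at h2
      change killCompl _ (X i.1) ∈ _ at this
      rwa [h2] at this
  refine gradeGE_iff_of_surjective (killCompl Subtype.val_injective :
      MvPolynomial V K →ₐ[K] MvPolynomial s K).toRingHom
    (Submodule.mkQ (monIdeal K (faceExp Γ)))
    ((Submodule.mkQ (monIdeal K (faceExp Γ'))).toAddMonoidHom.comp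
      (killCompl Subtype.val_injective :
        MvPolynomial V K →ₐ[K] MvPolynomial s K).toRingHom.toAddMonoidHom)
    (Submodule.mkQ_surjective _) ((Submodule.mkQ_surjective _).comp killCompl_surjective)
    (fun p ↦ ?_) (fun a p ↦ ?_) hmap.le (hmap.ge.trans Ideal.le_radical)
  · refine (Submodule.Quotient.mk_eq_zero _).trans
      (Iff.trans ?_ (Submodule.Quotient.mk_eq_zero _).symm)
    change _ ↔ killCompl Subtype.val_injective p ∈ _
    simp only [mem_monIdeal, coeff_killCompl, mem_faceExp, h, ← support_mapDomain_val]
    refine ⟨fun hp m hm ↦ hp _ hm, fun hp m hm hmΓ ↦ ?_⟩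
    obtain ⟨m, rfl⟩ := exists_mapDomain_val_eq (hs _ hmΓ)
    exact hp m hm hmΓ
  · exact congrArg (Submodule.mkQ (monIdeal K (faceExp Γ')))
      (map_mul (killCompl Subtype.val_injective : MvPolynomial V K →ₐ[K] MvPolynomial s K) a p)

lemma ringKrullDim_quotient_facePrime_le (F : Finset V) :
    ringKrullDim (MvPolynomial V K ⧸ facePrime K F) ≤ F.card := by
  have hker : RingHom.ker (killCompl Subtype.val_injective :
      MvPolynomial V K →ₐ[K] MvPolynomial (F : Set V) K).toRingHom ≤ facePrime K F := by
    intro p hp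
    rw [facePrime, mem_ideal_span_X_image]
    intro m hm
    by_contra! hcon
    obtain ⟨m, rfl⟩ := exists_mapDomain_val_eq (s := (F : Set V)) (m := m) (fun i hi ↦ by
      by_contra hiF
      exact (Finsupp.mem_support_iff.1 hi) (hcon i hiF))
    rw [mem_support_iff, ← coeff_killCompl Subtype.val_injective] at hm
    have hp : killCompl Subtype.val_injective p = 0 := hp
    simp [hp] at hm
  calc ringKrullDim (MvPolynomial V K ⧸ facePrime K F)
      ≤ ringKrullDim (MvPolynomial V K ⧸ RingHom.ker (killCompl Subtype.val_injective :
          MvPolynomial V K →ₐ[K] MvPolynomial (F : Set V) K).toRingHom) :=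
        ringKrullDim_le_of_surjective _ (Ideal.Quotient.factor_surjective hker)
    _ = ringKrullDim (MvPolynomial (F : Set V) K) :=
        ringKrullDim_eq_of_ringEquiv (RingHom.quotientKerEquivOfSurjective killCompl_surjective)
    _ = F.card := by
        rw [MvPolynomial.ringKrullDim_of_isNoetherianRing, ringKrullDim_eq_zero_of_field]
        simp

lemma card_le_ringKrullDim {Γ : LowerSet (Finset V)} {F : Finset V} (hF : F ∈ Γ) :
    F.card ≤ ringKrullDim (MvPolynomial V K ⧸ monIdeal K (faceExp Γ)) := by
  have hle : ∀ p ∈ monIdeal K (faceExp Γ), (killCompl Subtype.val_injective :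
      MvPolynomial V K →ₐ[K] MvPolynomial (F : Set V) K).toRingHom p = 0 := by
    intro p hp
    rw [mem_monIdeal] at hp
    ext m
    change coeff m (killCompl _ p) = 0
    rw [coeff_killCompl]
    by_contra hm
    refine hp _ hm (Γ.lower ?_ hF)
    rw [support_mapDomain_val]
    intro i hi
    obtain ⟨j, -, rfl⟩ := Finset.mem_map.1 hi
    exact j.2
  calc (F.card : WithBot ℕ∞) = ringKrullDim (MvPolynomial (F : Set V) K) := by
        rw [MvPolynomial.ringKrullDim_of_isNoetherianRing, ringKrullDim_eq_zero_of_field]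
        simp
    _ ≤ _ := ringKrullDim_le_of_surjective (Ideal.Quotient.lift _ _ hle)
        (Ideal.Quotient.lift_surjective_of_surjective _ hle killCompl_surjective)

end Subtype

lemma ringKrullDim_quotient_edgeIdeal [Fintype V] :
    ringKrullDim (MvPolynomial V K ⧸ edgeIdeal K G) = indepNumber G := by
  classical
  apply le_antisymm
  · rw [ringKrullDim_quotient]
    refine iSup_le fun l ↦ ?_
    set F : Finset V := Finset.univ.filter fun i ↦ X i ∉ l.head.1.asIdeal with hFdef
    have hmem : ∀ i, i ∈ F ↔ X i ∉ l.head.1.asIdeal := by simp [hFdef]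
    have hF : F ∈ indepFaces G := by
      intro i hi j hj hij
      have h1 : X i * X j ∈ l.head.1.asIdeal := l.head.2 (Ideal.subset_span ⟨i, j, hij, rfl⟩)
      rcases l.head.1.2.mem_or_mem h1 with h | h
      · exact (hmem i).1 hi h
      · exact (hmem j).1 hj h
    have hle : ∀ i, (l i).1 ∈ PrimeSpectrum.zeroLocus (facePrime K F : Set (MvPolynomial V K)) := by
      intro i
      have h1 : facePrime K F ≤ l.head.1.asIdeal := by
        rw [facePrime, Ideal.span_le]
        rintro _ ⟨j, hj, rfl⟩
        by_contra hc
        exact hj ((hmem j).2 hc)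
      exact h1.trans (l.head_le i)
    let l' : LTSeries (PrimeSpectrum.zeroLocus (facePrime K F : Set (MvPolynomial V K))) :=
      ⟨l.length, fun i ↦ ⟨(l i).1, hle i⟩, fun i ↦ l.step i⟩
    have h2 := Order.LTSeries.length_le_krullDim l'
    rw [← ringKrullDim_quotient] at h2
    refine h2.trans ((ringKrullDim_quotient_facePrime_le F).trans ?_)
    exact_mod_cast card_le_indepNumber hF
  · obtain ⟨F, hF, hcard⟩ := exists_card_eq_indepNumber G
    rw [← hcard, edgeIdeal_eq_monIdeal]
    exact card_le_ringKrullDim hF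

lemma quotCM_iff_gradeGE [Finite V] {I : Ideal (MvPolynomial V K)} {d : ℕ}
    (hd : ringKrullDim (MvPolynomial V K ⧸ I) = d) :
    quotCM K V I ↔ GradeGE (maxIdeal K V) (MvPolynomial V K ⧸ I) d := by
  rw [gradeGE_iff_localCohomology, quotCM, hd]
  refine forall_congr' fun i ↦ imp_congr ?_ Iff.rfl
  exact Nat.cast_lt (α := WithBot ℕ∞)

lemma quotCM_srIdeal_iff [Fintype V] :
    quotCM K V (srIdeal K (indepComplex G)) ↔ FaceGrade K (indepFaces G) (indepNumber G) := by
  have : srIdeal K (indepComplex G) = monIdeal K (faceExp (indepFaces G)) :=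
    srIdeal_eq_monIdeal (indepFaces G)
  rw [this, quotCM_iff_gradeGE (d := indepNumber G)]
  · rfl
  · rw [← edgeIdeal_eq_monIdeal, ringKrullDim_quotient_edgeIdeal]

lemma quotCM_edgeIdeal_sq_iff [Fintype V] [DecidableEq V] :
    quotCM K V (edgeIdeal K G ^ 2) ↔ MonGrade K (squareExp G) (indepNumber G) := by
  rw [quotCM_iff_gradeGE (d := indepNumber G), edgeIdeal_sq_eq_monIdeal]
  · rfl
  · rw [ringKrullDim_quotient, PrimeSpectrum.zeroLocus_pow _ two_ne_zero,
      ← ringKrullDim_quotient, ringKrullDim_quotient_edgeIdeal]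

section Localization

variable {p q : V}

lemma subset_edgeLocSet_of_mem {H : Finset V} (hH : H ∈ edgeFaces G p q) :
    ↑H ⊆ edgeLocSet G p q := by
  intro v hv
  have := hH.2 v hv
  simpa [edgeLocSet] using this

lemma mem_indepFaces_edgeLoc_iff (H : Finset (edgeLocSet G p q)) :
    H ∈ indepFaces (edgeLoc G p q) ↔ H.map (Function.Embedding.subtype _) ∈ edgeFaces G p q := by
  rw [mem_edgeFaces, and_iff_left]
  · simp only [mem_indepFaces, Finset.forall_mem_map]
    rfl
  · rw [Finset.forall_mem_map]
    intro v hv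
    exact ⟨fun h ↦ v.2 (Or.inl h), fun h ↦ v.2 (Or.inr h)⟩

lemma faceGrade_edgeLoc_iff [Finite V] {d : ℕ} :
    FaceGrade K (edgeFaces G p q) d ↔ FaceGrade K (indepFaces (edgeLoc G p q)) d :=
  faceGrade_subtype_iff (fun _ ↦ subset_edgeLocSet_of_mem) mem_indepFaces_edgeLoc_iff

lemma indepNumber_edgeLoc_add_one_eq [Fintype V] [DecidableEq V] (hpq : G.Adj p q)
    (h : ∃ T ∈ edgeFaces G p q, T.card + 1 = indepNumber G) :
    indepNumber (edgeLoc G p q) + 1 = indepNumber G := by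
  classical
  have : Fintype (edgeLocSet G p q) := Fintype.ofFinite _
  apply le_antisymm
  · obtain ⟨T, hT, hcard⟩ := exists_card_eq_indepNumber (edgeLoc G p q)
    rw [← hcard, ← Finset.card_map (Function.Embedding.subtype _)]
    exact card_add_one_le_of_mem_edgeFaces hpq ((mem_indepFaces_edgeLoc_iff T).1 hT)
  · obtain ⟨T, hT, hcard⟩ := h
    have e : (T.subtype (· ∈ edgeLocSet G p q)).map (Function.Embedding.subtype _) = T :=
      Finset.subtype_map_of_mem fun v hv ↦ subset_edgeLocSet_of_mem hT hv
    rw [← e] at hT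
    rw [← hcard, ← e, Finset.card_map]
    exact Nat.add_le_add_right (card_le_indepNumber ((mem_indepFaces_edgeLoc_iff _).2 hT)) 1

end Localization

lemma graphCM_iff [Finite V] :
    graphCM G ↔ ∀ (k : Type) [Field k], FaceGrade k (indepFaces G) (indepNumber G) := by
  have : Fintype V := Fintype.ofFinite V
  exact forall_congr' fun k ↦ forall_congr' fun _ ↦ quotCM_srIdeal_iff

end EdgeIdeals

/-- **Corollary 2.4.** `S/I(G)²` is Cohen–Macaulay if and only if `G` is special
Cohen–Macaulay and has no triangles. -/
theorem second_power_CM_iff {n : ℕ} (k : Type) [Field k]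
    (G : SimpleGraph (Fin n)) (hiso : noIsolated G) :
    quotCM k (Fin n) ((edgeIdeal k G) ^ 2) ↔ (specialCM G ∧ G.CliqueFree 3) := by
  rw [quotCM_edgeIdeal_sq_iff]
  constructor
  · intro h
    have key := fun (K : Type) [Field K] ↦ h.faceGrade_of_squareExp K hiso
    refine ⟨⟨graphCM_iff.2 fun K _ ↦ (key K).1, fun p q hpq ↦ ?_⟩, h.cliqueFree⟩
    have hnum := indepNumber_edgeLoc_add_one_eq hpq
      (exists_card_add_one_eq_of_faceGrade hpq ((key k).2 p q hpq))
    refine ⟨graphCM_iff.2 fun K _ ↦ ?_, hnum⟩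
    rw [← faceGrade_edgeLoc_iff, show indepNumber (edgeLoc G p q) = indepNumber G - 1 by omega]
    exact (key K).2 p q hpq
  · rintro ⟨⟨hCM, hloc⟩, hG⟩
    refine monGrade_squareExp hG (graphCM_iff.1 hCM k) fun p q hpq ↦ ?_
    obtain ⟨h1, h2⟩ := hloc p q hpq
    rw [faceGrade_edgeLoc_iff, show indepNumber G - 1 = indepNumber (edgeLoc G p q) by omega]
    exact graphCM_iff.1 h1 k
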